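/- (Removability of a point singularity, Proposition 2.4, gradient integrability) Let f : D∖{0} → ℝⁿ be smooth and bounded, weakly conformal, with Δf = 0 at every point where ∇f = 0. Assume the energy E(f, D∖{0}) = ∫_{D∖{0}} |∇f|² is finite and the Willmore energy W(f, D∖{0}) is finite. Then for every q ∈ (2,4), ∫_{D_{1/2}∖{0}} |∇f|^q < ∞. -/

import Mathlib

open MeasureTheory Set Filter
open scoped ENNReal Real RealInnerProductSpace

/-- Partial derivative in the first coordinate direction. -/
noncomputable def pd1 {n : ℕ} (f : ℝ × ℝ → EuclideanSpace ℝ (Fin n)) (z : ℝ × ℝ) :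
    EuclideanSpace ℝ (Fin n) := fderiv ℝ f z (1, 0)

/-- Partial derivative in the second coordinate direction. -/
noncomputable def pd2 {n : ℕ} (f : ℝ × ℝ → EuclideanSpace ℝ (Fin n)) (z : ℝ × ℝ) :
    EuclideanSpace ℝ (Fin n) := fderiv ℝ f z (0, 1)

/-- `|∇f|²`. -/
noncomputable def gradSq {n : ℕ} (f : ℝ × ℝ → EuclideanSpace ℝ (Fin n)) (z : ℝ × ℝ) : ℝ :=
    ‖pd1 f z‖ ^ 2 + ‖pd2 f z‖ ^ 2

/-- The Laplacian `Δf = ∂²f/∂x² + ∂²f/∂y²`. -/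
noncomputable def lap {n : ℕ} (f : ℝ × ℝ → EuclideanSpace ℝ (Fin n)) (z : ℝ × ℝ) :
    EuclideanSpace ℝ (Fin n) := pd1 (pd1 f) z + pd2 (pd2 f) z

/-- The Willmore energy `W(f, Ω) = ∫_{Ω ∩ {∇f ≠ 0}} |Δf|²/|∇f|²`. -/
noncomputable def willmore {n : ℕ} (f : ℝ × ℝ → EuclideanSpace ℝ (Fin n))
    (Ω : Set (ℝ × ℝ)) : ℝ≥0∞ :=
  ∫⁻ z in Ω ∩ {w | gradSq f w ≠ 0}, ENNReal.ofReal (‖lap f z‖ ^ 2 / gradSq f z)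

/-- The open disk of radius `r` centered at the origin of `ℝ²`. -/
def disk (r : ℝ) : Set (ℝ × ℝ) := {z | z.1 ^ 2 + z.2 ^ 2 < r ^ 2}

/-! ### Riesz kernels on the plane -/

theorem lintegral_radial : ∃ K : ℝ, 0 ≤ K ∧ ∀ g : ℝ → ℝ, (∀ t, 0 ≤ g t) →
    IntegrableOn (fun t => t * g t) (Ioi 0) →
    ∫⁻ z : ℝ × ℝ, ENNReal.ofReal (g ‖z‖) = ENNReal.ofReal (K * ∫ t in Ioi 0, t * g t) := by
  refine ⟨2 * (volume : Measure (ℝ × ℝ)).real (Metric.ball 0 1), by positivity, ?_⟩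
  intro g hg hint
  have h2 : Module.finrank ℝ (ℝ × ℝ) = 2 := by simp
  have hi : Integrable (fun z : ℝ × ℝ => g ‖z‖) := by
    rw [integrable_fun_norm_addHaar volume, h2]
    simpa using hint
  rw [← ofReal_integral_eq_lintegral_ofReal hi (ae_of_all _ fun z => hg _),
    integral_fun_norm_addHaar, h2]
  simp [mul_assoc]

theorem enorm_rpow_neg_eq {z : ℝ × ℝ} (hz : z ≠ 0) (s : ℝ) :
    ‖z‖ₑ ^ (-s) = ENNReal.ofReal (‖z‖ ^ (-s)) := by
  rw [← ofReal_norm, ENNReal.ofReal_rpow_of_pos (norm_pos_iff.2 hz)]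

theorem lintegral_riesz_ball (s : ℝ) (hs : s < 2) : ∃ C : ℝ≥0∞, C ≠ ⊤ ∧ ∀ (x : ℝ × ℝ) (R : ℝ), 0 < R →
    ∫⁻ y in Metric.ball x R, ‖x - y‖ₑ ^ (-s) ≤ C * ENNReal.ofReal (R ^ (2 - s)) := by
  obtain ⟨K, hK, hrad⟩ := lintegral_radial
  refine ⟨ENNReal.ofReal (K / (2 - s)), ENNReal.ofReal_ne_top, fun x R hR => ?_⟩
  have h1 : ∫⁻ y in Metric.ball x R, ‖x - y‖ₑ ^ (-s) =
      ∫⁻ z : ℝ × ℝ, (Metric.ball (0 : ℝ × ℝ) R).indicator (fun z => ‖z‖ₑ ^ (-s)) z := by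
    rw [← lintegral_indicator measurableSet_ball, ← lintegral_sub_left_eq_self _ x]
    congr 1 with y
    simp [indicator, Metric.mem_ball, dist_eq_norm]
  have hfun : ∀ t ∈ Ioi (0 : ℝ), t * (Iio R).indicator (fun t => |t| ^ (-s)) t =
      (Iio R).indicator (fun t => t ^ (1 - s)) t := by
    intro t ht
    by_cases h : t < R
    · have ht' : 0 < t := ht
      simp only [indicator, mem_Iio, h, if_true, abs_of_pos ht', sub_eq_add_neg,
        Real.rpow_add ht', Real.rpow_one]
    · simp [indicator, h]
  have hset : Ioi (0 : ℝ) ∩ Iio R = Ioo 0 R := rfl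
  have hint : IntegrableOn (fun t : ℝ => t ^ (1 - s)) (Ioo 0 R) := by
    rw [intervalIntegral.integrableOn_Ioo_rpow_iff hR]; linarith
  rw [h1, lintegral_congr_ae (g := fun z => ENNReal.ofReal
      ((fun t => (Iio R).indicator (fun t => |t| ^ (-s)) t) ‖z‖)), hrad]
  · rw [setIntegral_congr_fun measurableSet_Ioi hfun, setIntegral_indicator measurableSet_Iio, hset,
      ← integral_Ioc_eq_integral_Ioo, ← intervalIntegral.integral_of_le hR.le,
      integral_rpow (Or.inl (by linarith)), ← ENNReal.ofReal_mul (div_nonneg hK (by linarith))]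
    rw [Real.zero_rpow (by linarith)]
    apply le_of_eq
    congr 1
    rw [show 1 - s + 1 = 2 - s by ring]
    ring
  · intro t
    exact indicator_nonneg (fun t _ => by positivity) _
  · rw [integrableOn_congr_fun hfun measurableSet_Ioi, integrableOn_indicator_iff measurableSet_Iio,
      inter_comm, hset]
    exact hint
  · filter_upwards [compl_mem_ae_iff.2 (measure_singleton (0 : ℝ × ℝ))] with z hz
    by_cases h : ‖z‖ < R
    · simp [indicator, h, enorm_rpow_neg_eq hz]
    · simp [indicator, h]

theorem lintegral_riesz_compl_ball (s : ℝ) (hs : 2 < s) :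
    ∃ C : ℝ≥0∞, C ≠ ⊤ ∧ ∀ (x : ℝ × ℝ) (R : ℝ), 0 < R →
    ∫⁻ y in (Metric.ball x R)ᶜ, ‖x - y‖ₑ ^ (-s) ≤ C * ENNReal.ofReal (R ^ (2 - s)) := by
  obtain ⟨K, hK, hrad⟩ := lintegral_radial
  refine ⟨ENNReal.ofReal (K / (s - 2)), ENNReal.ofReal_ne_top, fun x R hR => ?_⟩
  have h1 : ∫⁻ y in (Metric.ball x R)ᶜ, ‖x - y‖ₑ ^ (-s) =
      ∫⁻ z : ℝ × ℝ, (Metric.ball (0 : ℝ × ℝ) R)ᶜ.indicator (fun z => ‖z‖ₑ ^ (-s)) z := by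
    rw [← lintegral_indicator measurableSet_ball.compl, ← lintegral_sub_left_eq_self _ x]
    congr 1 with y
    simp [indicator, Metric.mem_ball, dist_eq_norm]
  have hfun : ∀ t ∈ Ioi (0 : ℝ), t * (Ici R).indicator (fun t => |t| ^ (-s)) t =
      (Ici R).indicator (fun t => t ^ (1 - s)) t := by
    intro t ht
    by_cases h : R ≤ t
    · have ht' : 0 < t := ht
      simp only [indicator, mem_Ici, h, if_true, abs_of_pos ht', sub_eq_add_neg,
        Real.rpow_add ht', Real.rpow_one]
    · simp [indicator, h]
  have hset : Ioi (0 : ℝ) ∩ Ici R = Ici R := inter_eq_right.2 fun t ht => hR.trans_le ht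
  have hint : IntegrableOn (fun t : ℝ => t ^ (1 - s)) (Ici R) := by
    rw [integrableOn_Ici_iff_integrableOn_Ioi, integrableOn_Ioi_rpow_iff hR]; linarith
  rw [h1, lintegral_congr_ae (g := fun z => ENNReal.ofReal
      ((fun t => (Ici R).indicator (fun t => |t| ^ (-s)) t) ‖z‖)), hrad]
  · rw [setIntegral_congr_fun measurableSet_Ioi hfun, setIntegral_indicator measurableSet_Ici, hset,
      integral_Ici_eq_integral_Ioi, integral_Ioi_rpow_of_lt (by linarith) hR,
      ← ENNReal.ofReal_mul (div_nonneg hK (by linarith))]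
    apply le_of_eq
    congr 1
    rw [show 1 - s + 1 = 2 - s by ring, show s - 2 = -(2 - s) by ring, div_neg, neg_div]
    ring
  · intro t
    exact indicator_nonneg (fun t _ => by positivity) _
  · rw [integrableOn_congr_fun hfun measurableSet_Ioi, integrableOn_indicator_iff measurableSet_Ici,
      inter_comm, hset]
    exact hint
  · filter_upwards [compl_mem_ae_iff.2 (measure_singleton (0 : ℝ × ℝ))] with z hz
    by_cases h : R ≤ ‖z‖
    · simp [indicator, h, enorm_rpow_neg_eq hz]
    · simp [indicator, h]

theorem ennreal_rpow_neg_le {x y : ℝ≥0∞} {s : ℝ} (hs : 0 ≤ s) (h : x ≤ y) : y ^ (-s) ≤ x ^ (-s) := by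
  rw [ENNReal.rpow_neg, ENNReal.rpow_neg, ENNReal.inv_le_inv]
  exact ENNReal.rpow_le_rpow h hs

theorem lintegral_riesz_ball_zero (s : ℝ) (hs0 : 0 ≤ s) (hs : s < 2) :
    ∃ C : ℝ≥0∞, C ≠ ⊤ ∧ ∀ (x : ℝ × ℝ) (R : ℝ), 0 < R →
    ∫⁻ y in Metric.ball (0 : ℝ × ℝ) R, ‖x - y‖ₑ ^ (-s) ≤ C * ENNReal.ofReal (R ^ (2 - s)) := by
  obtain ⟨C, hC, h⟩ := lintegral_riesz_ball s hs
  obtain ⟨C', hC', h'⟩ := lintegral_riesz_ball 0 (by norm_num)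
  refine ⟨C + C', by simp [hC, hC'], fun x R hR => ?_⟩
  have hle : ∀ y, (Metric.ball (0 : ℝ × ℝ) R).indicator (fun y => ‖x - y‖ₑ ^ (-s)) y ≤
      (Metric.ball x R).indicator (fun y => ‖x - y‖ₑ ^ (-s)) y +
      ENNReal.ofReal (R ^ (-s)) * (Metric.ball (0 : ℝ × ℝ) R).indicator (fun y => ‖0 - y‖ₑ ^ (-0 : ℝ)) y := by
    intro y
    by_cases hy : y ∈ Metric.ball (0 : ℝ × ℝ) R
    · by_cases hxy : y ∈ Metric.ball x R
      · simp [hy, hxy]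
      · have hR' : R ≤ ‖x - y‖ := by
          simpa [Metric.mem_ball, dist_eq_norm, norm_sub_rev] using hxy
        have hne : x - y ≠ 0 := norm_pos_iff.1 (hR.trans_le hR')
        simp only [indicator_of_mem hy, indicator_of_notMem hxy, enorm_rpow_neg_eq hne, zero_add,
          neg_zero, ENNReal.rpow_zero, mul_one]
        exact ENNReal.ofReal_le_ofReal (Real.rpow_le_rpow_of_nonpos hR hR' (by linarith))
    · simp [hy]
  rw [← lintegral_indicator measurableSet_ball]
  refine (lintegral_mono hle).trans ?_
  have hm : Measurable ((Metric.ball x R).indicator (fun y => ‖x - y‖ₑ ^ (-s))) :=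
    Measurable.indicator (by fun_prop) measurableSet_ball
  rw [lintegral_add_left hm, lintegral_const_mul' _ _ ENNReal.ofReal_ne_top,
    lintegral_indicator measurableSet_ball, lintegral_indicator measurableSet_ball, add_mul]
  refine add_le_add (h x R hR) ?_
  · refine (mul_le_mul_right (h' 0 R hR) _).trans ?_
    rw [mul_left_comm, ← ENNReal.ofReal_mul (by positivity), ← Real.rpow_add hR]
    apply le_of_eq; congr 3; ring

theorem lintegral_riesz_max (a b : ℝ) (ha : a < 2) (hb : 0 ≤ b) (hab : 2 < a + b) :
    ∃ C : ℝ≥0∞, C ≠ ⊤ ∧ ∀ (x : ℝ × ℝ) (R : ℝ), 0 < R →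
    ∫⁻ z, ‖x - z‖ₑ ^ (-a) * (max (ENNReal.ofReal R) ‖x - z‖ₑ) ^ (-b) ≤
      C * ENNReal.ofReal (R ^ (2 - a - b)) := by
  obtain ⟨C, hC, h⟩ := lintegral_riesz_ball a ha
  obtain ⟨C', hC', h'⟩ := lintegral_riesz_compl_ball (a + b) hab
  refine ⟨C + C', by simp [hC, hC'], fun x R hR => ?_⟩
  have hR0 : ENNReal.ofReal R ≠ 0 := by simpa using hR
  rw [← lintegral_add_compl _ (measurableSet_ball (x := x) (ε := R)), add_mul]
  gcongr
  · calc _ ≤ ∫⁻ z in Metric.ball x R, ENNReal.ofReal (R ^ (-b)) * ‖x - z‖ₑ ^ (-a) := by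
          refine lintegral_mono fun z => ?_
          rw [mul_comm]
          gcongr
          rw [← ENNReal.ofReal_rpow_of_pos hR]
          exact ennreal_rpow_neg_le (by linarith) (le_max_left _ _)
      _ ≤ ENNReal.ofReal (R ^ (-b)) * (C * ENNReal.ofReal (R ^ (2 - a))) := by
          rw [lintegral_const_mul' _ _ ENNReal.ofReal_ne_top]
          gcongr
          exact h x R hR
      _ = _ := by
          rw [mul_left_comm, ← ENNReal.ofReal_mul (by positivity), ← Real.rpow_add hR]
          congr 3; ring
  · refine le_trans ?_ ((h' x R hR).trans (le_of_eq (by congr 3; ring)))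
    refine setLIntegral_mono' measurableSet_ball.compl fun z hz => ?_
    have hR' : R ≤ ‖x - z‖ := by
      simpa [Metric.mem_ball, dist_eq_norm, norm_sub_rev] using hz
    have hne : ‖x - z‖ₑ ≠ 0 := by simpa using (norm_pos_iff.1 (hR.trans_le hR'))
    rw [neg_add, ENNReal.rpow_add _ _ hne enorm_ne_top]
    gcongr 1
    exact ennreal_rpow_neg_le (by linarith) (le_max_right _ _)

theorem lintegral_riesz_mul_riesz (a b : ℝ) (ha0 : 0 ≤ a) (hb0 : 0 ≤ b) (ha : a < 2) (hb : b < 2)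
    (hab : 2 < a + b) :
    ∃ C : ℝ≥0∞, C ≠ ⊤ ∧ ∀ x y : ℝ × ℝ,
    ∫⁻ z, ‖x - z‖ₑ ^ (-a) * ‖z - y‖ₑ ^ (-b) ≤ C * ‖x - y‖ₑ ^ (-(a + b - 2)) := by
  obtain ⟨C, hC, h⟩ := lintegral_riesz_max a b ha hb0 hab
  obtain ⟨C', hC', h'⟩ := lintegral_riesz_max b a hb ha0 (by linarith)
  refine ⟨(C + C' + 1) * ENNReal.ofReal ((1 / 2) ^ (2 - a - b)),
    ENNReal.mul_ne_top (by simp [hC, hC']) ENNReal.ofReal_ne_top, fun x y => ?_⟩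
  rcases eq_or_ne x y with rfl | hxy
  · have h0 : a + b - 2 ≠ 0 := by linarith
    have : ‖x - x‖ₑ ^ (-(a + b - 2)) = ⊤ := by
      rw [sub_self, enorm_zero, ENNReal.zero_rpow_of_neg (by linarith)]
    rw [this, ENNReal.mul_top]
    · exact le_top
    · refine mul_ne_zero (by simp) ?_
      simp only [ne_eq, ENNReal.ofReal_eq_zero, not_le]
      positivity
  have hne : x - y ≠ 0 := sub_ne_zero.2 hxy
  set R : ℝ := ‖x - y‖ / 2 with hRdef
  have hR : 0 < R := by have := norm_pos_iff.2 hne; positivity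
  have key : ∀ z, ‖x - z‖ₑ ^ (-a) * ‖z - y‖ₑ ^ (-b) ≤
      ‖x - z‖ₑ ^ (-a) * (max (ENNReal.ofReal R) ‖x - z‖ₑ) ^ (-b) +
      ‖y - z‖ₑ ^ (-b) * (max (ENNReal.ofReal R) ‖y - z‖ₑ) ^ (-a) := by
    intro z
    have htri : ‖x - y‖ ≤ ‖x - z‖ + ‖y - z‖ := by
      rw [norm_sub_rev y z]; exact norm_sub_le_norm_sub_add_norm_sub x z y
    rw [← enorm_neg (z - y), neg_sub]
    rcases le_total ‖x - z‖ ‖y - z‖ with hle | hle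
    · refine le_trans ?_ le_self_add
      gcongr 1
      refine ennreal_rpow_neg_le (by linarith) (max_le ?_ ?_)
      · rw [← ofReal_norm]; exact ENNReal.ofReal_le_ofReal (by linarith)
      · exact enorm_le_iff_norm_le.2 hle
    · refine le_trans ?_ le_add_self
      rw [mul_comm]
      gcongr 1
      refine ennreal_rpow_neg_le (by linarith) (max_le ?_ ?_)
      · rw [← ofReal_norm]; exact ENNReal.ofReal_le_ofReal (by linarith)
      · exact enorm_le_iff_norm_le.2 hle
  refine (lintegral_mono key).trans ?_
  rw [lintegral_add_left (by fun_prop)]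
  have e : ENNReal.ofReal (R ^ (2 - a - b)) =
      ENNReal.ofReal ((1 / 2) ^ (2 - a - b)) * ‖x - y‖ₑ ^ (-(a + b - 2)) := by
    rw [enorm_rpow_neg_eq hne, ← ENNReal.ofReal_mul (by positivity),
      show -(a + b - 2) = 2 - a - b by ring, ← Real.mul_rpow (by positivity) (norm_nonneg _), hRdef]
    congr 2; ring
  calc _ ≤ C * ENNReal.ofReal (R ^ (2 - a - b)) + C' * ENNReal.ofReal (R ^ (2 - a - b)) := by
        refine add_le_add (h x R hR) ((h' y R hR).trans (le_of_eq ?_))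
        congr 3; ring
    _ ≤ (C + C' + 1) * ENNReal.ofReal (R ^ (2 - a - b)) := by
        rw [← add_mul]; exact mul_le_mul_left le_self_add _
    _ = _ := by rw [e, mul_assoc]

theorem sq_lintegral_le_mul {α : Type*} [MeasurableSpace α] {μ : Measure α} {c f g : α → ℝ≥0∞}
    (hf : AEMeasurable f μ) (hg : AEMeasurable g μ) (h : ∀ x, c x ^ 2 ≤ f x * g x) :
    (∫⁻ x, c x ∂μ) ^ 2 ≤ (∫⁻ x, f x ∂μ) * ∫⁻ x, g x ∂μ := by
  have hc : ∀ x, c x ≤ f x ^ (1 / 2 : ℝ) * g x ^ (1 / 2 : ℝ) := fun x => by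
    rw [← ENNReal.mul_rpow_of_nonneg _ _ (by norm_num)]
    calc c x = (c x ^ 2) ^ (1 / 2 : ℝ) := by
          rw [← ENNReal.rpow_natCast, ← ENNReal.rpow_mul]; norm_num
      _ ≤ _ := ENNReal.rpow_le_rpow (h x) (by norm_num)
  have := (lintegral_mono hc).trans
    (ENNReal.lintegral_mul_norm_pow_le hf hg (p := 1 / 2) (q := 1 / 2) (by norm_num) (by norm_num)
      (by norm_num))
  calc _ ≤ ((∫⁻ x, f x ∂μ) ^ (1 / 2 : ℝ) * (∫⁻ x, g x ∂μ) ^ (1 / 2 : ℝ)) ^ 2 := by gcongr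
    _ = _ := by
      rw [mul_pow, ← ENNReal.rpow_natCast, ← ENNReal.rpow_natCast, ← ENNReal.rpow_mul,
        ← ENNReal.rpow_mul]
      norm_num

theorem enorm_rpow_sq (z : ℝ × ℝ) {s t : ℝ} (hst : s + s = t) : (‖z‖ₑ ^ (-s)) ^ 2 = ‖z‖ₑ ^ (-t) := by
  rw [← ENNReal.rpow_natCast, ← ENNReal.rpow_mul]
  congr 1; push_cast; linarith

theorem enorm_rpow_mul_sq (z : ℝ × ℝ) {s t r : ℝ} (ht : 0 < t) (hr : 0 < r) (hst : t + r = s + s) :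
    (‖z‖ₑ ^ (-s)) ^ 2 = ‖z‖ₑ ^ (-t) * ‖z‖ₑ ^ (-r) := by
  rw [enorm_rpow_sq z (t := t + r) hst.symm]
  rcases eq_or_ne ‖z‖ₑ 0 with h | h
  · rw [h, ENNReal.zero_rpow_of_neg (by linarith), ENNReal.zero_rpow_of_neg (by linarith),
      ENNReal.zero_rpow_of_neg (by linarith)]
    rfl
  · rw [neg_add, ENNReal.rpow_add _ _ h enorm_ne_top]

theorem sq_lintegral_mul_riesz_le {a : ℝ × ℝ → ℝ≥0∞} (ha : Measurable a) (x : ℝ × ℝ) {s t r : ℝ}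
    (ht : 0 < t) (hr : 0 < r) (hst : t + r = s + s) :
    (∫⁻ w, a w * ‖x - w‖ₑ ^ (-s)) ^ 2 ≤
      (∫⁻ w, a w * ‖x - w‖ₑ ^ (-t)) * ∫⁻ w, a w * ‖x - w‖ₑ ^ (-r) := by
  refine sq_lintegral_le_mul (by fun_prop) (by fun_prop) fun w => le_of_eq ?_
  rw [mul_pow, enorm_rpow_mul_sq _ ht hr hst]
  ring

theorem ennreal_add_sq_le (p q : ℝ≥0∞) : (p + q) ^ 2 ≤ 4 * p ^ 2 + 4 * q ^ 2 := by
  rcases le_total p q with h | h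
  · calc (p + q) ^ 2 ≤ (q + q) ^ 2 := by gcongr
      _ = 4 * q ^ 2 := by ring
      _ ≤ _ := le_add_self
  · calc (p + q) ^ 2 ≤ (p + p) ^ 2 := by gcongr
      _ = 4 * p ^ 2 := by ring
      _ ≤ _ := le_self_add

/-- A Riesz potential of order one maps the class `sup ∫ a |x - w|^(-3/4) < ∞` into the class
`sup ∫ u² |x - z|^(-3/2) < ∞`. -/
theorem lintegral_sq_potential_le : ∃ C : ℝ≥0∞, C ≠ ⊤ ∧ ∀ (a : ℝ × ℝ → ℝ≥0∞) (B : ℝ≥0∞), Measurable a →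
    (∀ x, ∫⁻ w, a w * ‖x - w‖ₑ ^ (-(3 / 4) : ℝ) ≤ B) → ∀ x,
    ∫⁻ z, (∫⁻ w, a w * ‖z - w‖ₑ ^ (-1 : ℝ)) ^ 2 * ‖x - z‖ₑ ^ (-(3 / 2) : ℝ) ≤ C * B ^ 2 := by
  obtain ⟨C, hC, h⟩ := lintegral_riesz_mul_riesz (3 / 2) (5 / 4) (by norm_num) (by norm_num)
    (by norm_num) (by norm_num) (by norm_num)
  refine ⟨C, hC, fun a B ha hB x => ?_⟩
  calc _ ≤ ∫⁻ z, B * ∫⁻ w, a w * (‖x - z‖ₑ ^ (-(3 / 2) : ℝ) * ‖z - w‖ₑ ^ (-(5 / 4) : ℝ)) := by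
        refine lintegral_mono fun z => ?_
        have h1 := (sq_lintegral_mul_riesz_le ha z (s := 1) (t := 3 / 4) (r := 5 / 4)
          (by norm_num) (by norm_num) (by norm_num)).trans (mul_le_mul_left (hB z) _)
        calc _ ≤ (B * ∫⁻ w, a w * ‖z - w‖ₑ ^ (-(5 / 4) : ℝ)) * ‖x - z‖ₑ ^ (-(3 / 2) : ℝ) := by
              gcongr
          _ = _ := by
              rw [mul_assoc, ← lintegral_mul_const _ (by fun_prop)]
              congr 1
              refine lintegral_congr fun w => ?_
              ring
    _ = B * ∫⁻ w, a w * ∫⁻ z, ‖x - z‖ₑ ^ (-(3 / 2) : ℝ) * ‖z - w‖ₑ ^ (-(5 / 4) : ℝ) := by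
        rw [lintegral_const_mul _ (by fun_prop), lintegral_lintegral_swap (by fun_prop)]
        congr 1
        refine lintegral_congr fun w => ?_
        rw [lintegral_const_mul _ (by fun_prop)]
    _ ≤ B * ∫⁻ w, a w * (C * ‖x - w‖ₑ ^ (-(3 / 4) : ℝ)) := by
        gcongr with w
        refine (h x w).trans (le_of_eq ?_)
        norm_num
    _ = C * (B * ∫⁻ w, a w * ‖x - w‖ₑ ^ (-(3 / 4) : ℝ)) := by
        simp only [mul_left_comm _ C]
        rw [lintegral_const_mul' _ _ hC, mul_left_comm]
    _ ≤ C * B ^ 2 := by rw [sq]; gcongr; exact hB x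

theorem lintegral_pow_four_potential_le : ∃ C : ℝ≥0∞, C ≠ ⊤ ∧
    ∀ (a : ℝ × ℝ → ℝ≥0∞) (B : ℝ≥0∞), Measurable a → (∀ w ∉ Metric.ball (0 : ℝ × ℝ) 1, a w = 0) →
    (∀ x, ∫⁻ w, a w * ‖x - w‖ₑ ^ (-(3 / 4) : ℝ) ≤ B) →
    ∫⁻ z in Metric.ball (0 : ℝ × ℝ) 1, (∫⁻ w, a w * ‖z - w‖ₑ ^ (-1 : ℝ)) ^ 4 ≤ C * B ^ 4 := by
  obtain ⟨C, hC, h⟩ := lintegral_riesz_ball_zero (7 / 4) (by norm_num) (by norm_num)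
  refine ⟨C, hC, fun a B ha hsupp hB => ?_⟩
  have hmass : ∫⁻ w, a w ≤ B := by
    refine le_trans (lintegral_mono fun w => ?_) (hB 0)
    by_cases hw : w ∈ Metric.ball (0 : ℝ × ℝ) 1
    · have h1 : ‖0 - w‖ₑ ≤ 1 := by
        rw [← enorm_one (G := ℝ), enorm_le_iff_norm_le]
        simpa using (mem_ball_zero_iff.1 hw).le
      calc a w = a w * 1 ^ (-(3 / 4) : ℝ) := by simp
        _ ≤ _ := by gcongr 1; exact ennreal_rpow_neg_le (by norm_num) h1
    · simp [hsupp w hw]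
  calc _ ≤ ∫⁻ z in Metric.ball (0 : ℝ × ℝ) 1, B ^ 3 * ∫⁻ w, a w * ‖z - w‖ₑ ^ (-(7 / 4) : ℝ) := by
        refine lintegral_mono fun z => ?_
        have h1 := (sq_lintegral_mul_riesz_le ha z (s := 1) (t := 3 / 4) (r := 5 / 4)
          (by norm_num) (by norm_num) (by norm_num)).trans (mul_le_mul_left (hB z) _)
        have h2 := (sq_lintegral_mul_riesz_le ha z (s := 5 / 4) (t := 3 / 4) (r := 7 / 4)
          (by norm_num) (by norm_num) (by norm_num)).trans (mul_le_mul_left (hB z) _)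
        calc _ = ((∫⁻ w, a w * ‖z - w‖ₑ ^ (-1 : ℝ)) ^ 2) ^ 2 := by rw [← pow_mul]
          _ ≤ (B * ∫⁻ w, a w * ‖z - w‖ₑ ^ (-(5 / 4) : ℝ)) ^ 2 := by gcongr
          _ = B ^ 2 * (∫⁻ w, a w * ‖z - w‖ₑ ^ (-(5 / 4) : ℝ)) ^ 2 := by rw [mul_pow]
          _ ≤ B ^ 2 * (B * ∫⁻ w, a w * ‖z - w‖ₑ ^ (-(7 / 4) : ℝ)) := by gcongr
          _ = _ := by ring
    _ = B ^ 3 * ∫⁻ w, a w * ∫⁻ z in Metric.ball (0 : ℝ × ℝ) 1, ‖z - w‖ₑ ^ (-(7 / 4) : ℝ) := by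
        rw [lintegral_const_mul _ (by fun_prop), lintegral_lintegral_swap (by fun_prop)]
        congr 1
        refine lintegral_congr fun w => ?_
        rw [lintegral_const_mul _ (by fun_prop)]
    _ ≤ B ^ 3 * ∫⁻ w, a w * C := by
        gcongr with w
        have := h w 1 one_pos
        simp only [Real.one_rpow, ENNReal.ofReal_one, mul_one] at this
        refine le_trans (le_of_eq ?_) this
        refine lintegral_congr fun z => ?_
        rw [← enorm_neg, neg_sub]
    _ ≤ C * B ^ 4 := by
        rw [lintegral_mul_const _ ha]
        calc _ ≤ B ^ 3 * (B * C) := by gcongr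
          _ = _ := by ring

theorem lintegral_pow_four_le_of_le_potential : ∃ ε C : ℝ≥0∞, ε ≠ 0 ∧ C ≠ ⊤ ∧
    ∀ (u h b : ℝ × ℝ → ℝ≥0∞) (M T : ℝ≥0∞), Measurable u → Measurable h → Measurable b → M ≠ ⊤ → T ≠ ⊤ →
    (∀ z, u z ≤ ∫⁻ w, (h w * u w + b w) * ‖z - w‖ₑ ^ (-1 : ℝ)) →
    (∀ z ∉ Metric.ball (0 : ℝ × ℝ) 1, u z = 0) → (∀ z ∉ Metric.ball (0 : ℝ × ℝ) 1, b z = 0) →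
    (∀ z, u z ≤ M) → ∫⁻ z, h z ^ 2 ≤ ε →
    (∀ x, ∫⁻ w, b w * ‖x - w‖ₑ ^ (-(3 / 4) : ℝ) ≤ T) →
    ∫⁻ z, u z ^ 4 ≤ C * T ^ 4 := by
  obtain ⟨C₁, hC₁, h₁⟩ := lintegral_sq_potential_le
  obtain ⟨C₂, hC₂, h₂⟩ := lintegral_pow_four_potential_le
  obtain ⟨C₃, hC₃, h₃⟩ := lintegral_riesz_ball_zero (3 / 2) (by norm_num) (by norm_num)
  have hC₁' : 8 * (C₁ + 1) ≠ ⊤ := ENNReal.mul_ne_top (by simp) (by simp [hC₁])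
  refine ⟨(8 * (C₁ + 1))⁻¹, 64 * C₂, ENNReal.inv_ne_zero.2 hC₁', ENNReal.mul_ne_top (by simp) hC₂, ?_⟩
  intro u h b M T hu hh hb hM hT hle husupp hbsupp huM hhε hbT
  set N : ℝ≥0∞ := ⨆ x, ∫⁻ z, u z ^ 2 * ‖x - z‖ₑ ^ (-(3 / 2) : ℝ) with hN
  have hNtop : N ≠ ⊤ := by
    refine ne_top_of_le_ne_top (ENNReal.mul_ne_top (ENNReal.pow_ne_top (n := 2) hM) hC₃) (iSup_le fun x => ?_)
    have h3 := h₃ x 1 one_pos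
    simp only [Real.one_rpow, ENNReal.ofReal_one, mul_one] at h3
    calc _ ≤ ∫⁻ z, M ^ 2 * (Metric.ball (0 : ℝ × ℝ) 1).indicator (fun z => ‖x - z‖ₑ ^ (-(3 / 2) : ℝ)) z := by
          refine lintegral_mono fun z => ?_
          by_cases hz : z ∈ Metric.ball (0 : ℝ × ℝ) 1
          · simp only [hz, indicator_of_mem]; gcongr; exact huM z
          · simp [husupp z hz]
      _ ≤ _ := by
          rw [lintegral_const_mul' _ _ (ENNReal.pow_ne_top hM), lintegral_indicator measurableSet_ball]
          gcongr
  set a : ℝ × ℝ → ℝ≥0∞ := fun w => h w * u w + b w with ha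
  have ham : Measurable a := by fun_prop
  set B : ℝ≥0∞ := ⨆ x, ∫⁻ w, a w * ‖x - w‖ₑ ^ (-(3 / 4) : ℝ) with hB
  have hBx : ∀ x, ∫⁻ w, a w * ‖x - w‖ₑ ^ (-(3 / 4) : ℝ) ≤ B := le_iSup (fun x => ∫⁻ w, a w * ‖x - w‖ₑ ^ (-(3 / 4) : ℝ))
  have hB2 : B ^ 2 ≤ 4 * ((8 * (C₁ + 1))⁻¹ * N) + 4 * T ^ 2 := by
    have : ∀ x, (∫⁻ w, a w * ‖x - w‖ₑ ^ (-(3 / 4) : ℝ)) ^ 2 ≤ 4 * ((8 * (C₁ + 1))⁻¹ * N) + 4 * T ^ 2 := by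
      intro x
      simp only [ha, add_mul]
      rw [lintegral_add_left (by fun_prop)]
      refine (ennreal_add_sq_le _ _).trans ?_
      gcongr
      · calc _ ≤ (∫⁻ w, h w ^ 2) * ∫⁻ w, u w ^ 2 * ‖x - w‖ₑ ^ (-(3 / 2) : ℝ) := by
              refine sq_lintegral_le_mul (by fun_prop) (by fun_prop) fun w => le_of_eq ?_
              rw [mul_pow, mul_pow, enorm_rpow_sq _ (t := 3 / 2) (by norm_num)]
              ring
          _ ≤ _ := by
              gcongr
              exact le_iSup (fun x => ∫⁻ z, u z ^ 2 * ‖x - z‖ₑ ^ (-(3 / 2) : ℝ)) x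
      · exact hbT x
    have h2 : (B ^ (2 : ℝ)) = ⨆ x, (∫⁻ w, a w * ‖x - w‖ₑ ^ (-(3 / 4) : ℝ)) ^ (2 : ℝ) := by
      rw [hB]
      exact (ENNReal.orderIsoRpow 2 (by norm_num)).map_iSup _
    rw [← ENNReal.rpow_natCast]
    simp only [Nat.cast_ofNat]
    rw [h2]
    refine iSup_le fun x => ?_
    have := this x
    rwa [← ENNReal.rpow_natCast] at this
  have hNB : N ≤ C₁ * B ^ 2 := by
    refine iSup_le fun x => le_trans ?_ (h₁ a B ham hBx x)
    gcongr with z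
    exact hle z
  have hinv : (8 * (C₁ + 1)) * (8 * (C₁ + 1))⁻¹ = 1 :=
    ENNReal.mul_inv_cancel (by simp) hC₁'
  have hNhalf : N / 2 ≤ 4 * (C₁ + 1) * T ^ 2 := by
    have e : N ≤ N / 2 + 4 * (C₁ + 1) * T ^ 2 := by
      calc N ≤ (C₁ + 1) * B ^ 2 := hNB.trans (mul_le_mul_left le_self_add _)
        _ ≤ (C₁ + 1) * (4 * ((8 * (C₁ + 1))⁻¹ * N) + 4 * T ^ 2) := by gcongr
        _ = (8 * (C₁ + 1)) * (8 * (C₁ + 1))⁻¹ * (N / 2) + 4 * (C₁ + 1) * T ^ 2 := by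
            have h4 : (4 : ℝ≥0∞) = 8 * 2⁻¹ := by
              rw [show (8 : ℝ≥0∞) = 4 * 2 by norm_num, mul_assoc, ENNReal.mul_inv_cancel] <;> norm_num
            rw [div_eq_mul_inv, mul_add]
            congr 1
            · rw [h4]; ring
            · ring
        _ = _ := by rw [hinv, one_mul]
    have hN2 : N / 2 ≠ ⊤ := ENNReal.div_ne_top hNtop (by simp)
    nth_rewrite 1 [← ENNReal.add_halves N] at e
    exact (ENNReal.add_le_add_iff_left hN2).1 e
  have hBT : B ^ 2 ≤ 8 * T ^ 2 := by
    refine hB2.trans ?_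
    have : (8 * (C₁ + 1))⁻¹ * N ≤ T ^ 2 := by
      calc (8 * (C₁ + 1))⁻¹ * N = (8 * (C₁ + 1))⁻¹ * (2 * (N / 2)) := by
            rw [ENNReal.mul_div_cancel (by simp) (by simp)]
        _ ≤ (8 * (C₁ + 1))⁻¹ * (2 * (4 * (C₁ + 1) * T ^ 2)) := by gcongr
        _ = (8 * (C₁ + 1)) * (8 * (C₁ + 1))⁻¹ * T ^ 2 := by ring
        _ = T ^ 2 := by rw [hinv, one_mul]
    calc _ ≤ 4 * T ^ 2 + 4 * T ^ 2 := by gcongr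
      _ = _ := by ring
  calc ∫⁻ z, u z ^ 4 ≤ ∫⁻ z, (Metric.ball (0 : ℝ × ℝ) 1).indicator
          (fun z => (∫⁻ w, a w * ‖z - w‖ₑ ^ (-1 : ℝ)) ^ 4) z := by
        refine lintegral_mono fun z => ?_
        by_cases hz : z ∈ Metric.ball (0 : ℝ × ℝ) 1
        · simp only [hz, indicator_of_mem]; gcongr; exact hle z
        · simp [husupp z hz]
    _ ≤ C₂ * B ^ 4 := by
        rw [lintegral_indicator measurableSet_ball]
        refine h₂ a B ham (fun w hw => ?_) hBx
        simp [ha, husupp w hw, hbsupp w hw]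
    _ = C₂ * (B ^ 2) ^ 2 := by rw [← pow_mul]
    _ ≤ C₂ * (8 * T ^ 2) ^ 2 := by gcongr
    _ = _ := by ring

/-! ### The Cauchy–Pompeiu formula -/

/-- The identification of `ℝ²` with `ℂ`. -/
noncomputable def toC : ℝ × ℝ →L[ℝ] ℂ := Complex.equivRealProdCLM.symm

@[simp] theorem toC_re (v : ℝ × ℝ) : (toC v).re = v.1 := rfl

@[simp] theorem toC_im (v : ℝ × ℝ) : (toC v).im = v.2 := rfl

theorem norm_toC_sq (v : ℝ × ℝ) : ‖toC v‖ ^ 2 = v.1 ^ 2 + v.2 ^ 2 := by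
  rw [Complex.sq_norm, Complex.normSq_apply]; simp; ring

theorem norm_le_norm_toC (v : ℝ × ℝ) : ‖v‖ ≤ ‖toC v‖ := by
  rw [Prod.norm_def]
  exact max_le (Complex.abs_re_le_norm (toC v)) (Complex.abs_im_le_norm (toC v))

theorem toC_ne_zero {v : ℝ × ℝ} (hv : v ≠ 0) : toC v ≠ 0 :=
  norm_pos_iff.1 ((norm_pos_iff.2 hv).trans_le (norm_le_norm_toC v))

theorem integral_polar_eq {E : Type*} [NormedAddCommGroup E] [NormedSpace ℝ E] (f : ℝ × ℝ → E) :
    ∫ p, f p = ∫ p in Ioi (0 : ℝ) ×ˢ Ioo (-π) π, p.1 • f (p.1 * Real.cos p.2, p.1 * Real.sin p.2) :=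
  (integral_comp_polarCoord_symm f).symm

theorem integral_disk_eq_zero {H : ℝ × ℝ → ℝ} (hH : Continuous H) (R : ℝ)
    (h : ∀ r, 0 < r → r < R → ∫ θ in (-π)..π, H (r * Real.cos θ, r * Real.sin θ) = 0) :
    ∫ w in {w | ‖toC w‖ < R}, H w = 0 := by
  have hmeas : MeasurableSet {w : ℝ × ℝ | ‖toC w‖ < R} :=
    measurableSet_lt (by fun_prop) measurable_const
  rw [← integral_indicator hmeas, integral_polar_eq]
  have hnorm : ∀ p : ℝ × ℝ, 0 < p.1 → ‖toC (p.1 * Real.cos p.2, p.1 * Real.sin p.2)‖ = p.1 := by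
    intro p hp
    refine (sq_eq_sq₀ (norm_nonneg _) hp.le).1 ?_
    rw [norm_toC_sq]
    linear_combination p.1 ^ 2 * Real.sin_sq_add_cos_sq p.2
  have e : ∀ p ∈ Ioi (0 : ℝ) ×ˢ Ioo (-π) π, p.1 • ({w | ‖toC w‖ < R}.indicator H)
      (p.1 * Real.cos p.2, p.1 * Real.sin p.2) = (Iio R ×ˢ univ).indicator
        (fun p => p.1 * H (p.1 * Real.cos p.2, p.1 * Real.sin p.2)) p := by
    intro p hp
    have := hnorm p hp.1
    by_cases hR : p.1 < R
    · simp [indicator, this, hR]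
    · simp [indicator, this, hR]
  have hset : Ioi (0 : ℝ) ×ˢ Ioo (-π) π ∩ Iio R ×ˢ univ = Ioo 0 R ×ˢ Ioo (-π) π := by
    ext p; simp; tauto
  rw [setIntegral_congr_fun (measurableSet_Ioi.prod measurableSet_Ioo) e,
    setIntegral_indicator (measurableSet_Iio.prod .univ), hset, Measure.volume_eq_prod,
    setIntegral_prod]
  · rw [setIntegral_eq_zero_of_forall_eq_zero]
    intro r hr
    dsimp only
    rw [integral_const_mul, ← integral_Ioc_eq_integral_Ioo,
      ← intervalIntegral.integral_of_le (by linarith [Real.pi_pos]), h r hr.1 hr.2, mul_zero]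
  · have hc : Continuous fun p : ℝ × ℝ => p.1 * H (p.1 * Real.cos p.2, p.1 * Real.sin p.2) := by
      fun_prop
    exact (hc.continuousOn.integrableOn_compact (isCompact_Icc.prod isCompact_Icc)).mono_set
      (prod_mono Ioo_subset_Icc_self Ioo_subset_Icc_self)

theorem cauchy_pompeiu {U : ℝ × ℝ → ℂ} (hU : ContDiff ℝ 1 U) (hc : HasCompactSupport U) (z : ℝ × ℝ) :
    ∫ w, (fderiv ℝ U w (1, 0) + Complex.I * fderiv ℝ U w (0, 1)) / toC (w - z) = -(2 * π) * U z := by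
  have hdiff : Differentiable ℝ U := hU.differentiable one_ne_zero
  have hfd : Continuous (fderiv ℝ U) := hU.continuous_fderiv one_ne_zero
  rw [← integral_add_left_eq_self _ z, integral_polar_eq]
  set P : ℝ × ℝ → ℝ × ℝ := fun p => z + (p.1 * Real.cos p.2, p.1 * Real.sin p.2) with hP
  set a : ℝ × ℝ → ℂ := fun p => fderiv ℝ U (P p) (Real.cos p.2, Real.sin p.2) with ha
  set b : ℝ × ℝ → ℂ := fun p => fderiv ℝ U (P p) (-Real.sin p.2, Real.cos p.2) with hb
  have hPc : Continuous P := by fun_prop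
  have hac : Continuous a := by fun_prop
  have hbc : Continuous b := by fun_prop
  have e : ∀ p ∈ Ioi (0 : ℝ) ×ˢ Ioo (-π) π, p.1 •
      ((fderiv ℝ U (P p) (1, 0) + Complex.I * fderiv ℝ U (P p) (0, 1)) / toC (P p - z)) =
      a p + Complex.I * b p := by
    intro p hp
    have hp1 : (p.1 : ℂ) ≠ 0 := by exact_mod_cast (ne_of_gt hp.1)
    have h1 : toC (P p - z) = p.1 * (Real.cos p.2 + Real.sin p.2 * Complex.I) := by
      apply Complex.ext <;> simp [hP, Complex.cos_ofReal_re, Complex.sin_ofReal_re]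
    have h2 : ∀ s t : ℝ, fderiv ℝ U (P p) (s, t) =
        s * fderiv ℝ U (P p) (1, 0) + t * fderiv ℝ U (P p) (0, 1) := by
      intro s t
      have : ((s, t) : ℝ × ℝ) = s • (1, 0) + t • (0, 1) := by simp
      rw [this, map_add, map_smul, map_smul]
      simp
    have h3 : ((Real.cos p.2 : ℂ) + Real.sin p.2 * Complex.I) *
        (Real.cos p.2 - Real.sin p.2 * Complex.I) = 1 := by
      have := congrArg (fun x : ℝ => (x : ℂ)) (Real.sin_sq_add_cos_sq p.2)
      rw [Complex.ofReal_add, Complex.ofReal_pow, Complex.ofReal_pow, Complex.ofReal_one] at this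
      linear_combination this - (Real.sin p.2 : ℂ) ^ 2 * Complex.I_sq
    have h4 : ((Real.cos p.2 : ℂ) + Real.sin p.2 * Complex.I) ≠ 0 := left_ne_zero_of_mul_eq_one h3
    rw [h1, Complex.real_smul]
    simp only [ha, hb]
    rw [h2 (Real.cos p.2), h2 (-Real.sin p.2)]
    rw [Complex.ofReal_neg, ← mul_div_assoc, mul_div_mul_left _ _ hp1, div_eq_iff h4]
    linear_combination (-(fderiv ℝ U (P p) (1, 0) + Complex.I * fderiv ℝ U (P p) (0, 1))) * h3
      - (Real.sin p.2 * fderiv ℝ U (P p) (0, 1) * (Real.cos p.2 + Real.sin p.2 * Complex.I)) * Complex.I_sq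
  rw [setIntegral_congr_fun (measurableSet_Ioi.prod measurableSet_Ioo) e]
  obtain ⟨R, hR⟩ : ∃ R : ℝ, ∀ p : ℝ × ℝ, R < p.1 → U (P p) = 0 ∧ fderiv ℝ U (P p) = 0 := by
    obtain ⟨R, hR⟩ := hc.isCompact.isBounded.subset_closedBall z
    refine ⟨2 * R, fun p hp => ?_⟩
    have hnot : P p ∉ tsupport U := by
      intro hmem
      have h1 := hR hmem
      rw [Metric.mem_closedBall, dist_eq_norm] at h1
      have h2 : P p - z = (p.1 * Real.cos p.2, p.1 * Real.sin p.2) := by simp [hP]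
      rw [h2] at h1
      have h3 := (norm_fst_le _).trans h1
      have h4 := (norm_snd_le _).trans h1
      simp only [Real.norm_eq_abs] at h3 h4
      have h5 : p.1 ^ 2 ≤ R ^ 2 + R ^ 2 := by
        have h6 := sq_le_sq' (by linarith [abs_le.1 h3]) (abs_le.1 h3).2
        have h7 := sq_le_sq' (by linarith [abs_le.1 h4]) (abs_le.1 h4).2
        nlinarith [Real.sin_sq_add_cos_sq p.2]
      have h8 : 0 ≤ R := (abs_nonneg _).trans h3
      nlinarith
    exact ⟨image_eq_zero_of_notMem_tsupport hnot, by
      have := mt (fun h => support_fderiv_subset ℝ h) hnot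
      simpa using this⟩
  have hint : ∀ g : ℝ × ℝ → ℂ, Continuous g → (∀ p : ℝ × ℝ, R < p.1 → g p = 0) →
      IntegrableOn g (Ioi (0 : ℝ) ×ˢ Ioo (-π) π) (volume.prod volume) := by
    intro g hg hg0
    have h1 : IntegrableOn g (Icc 0 R ×ˢ Icc (-π) π) (volume.prod volume) :=
      hg.continuousOn.integrableOn_compact (isCompact_Icc.prod isCompact_Icc)
    refine h1.of_forall_sdiff_eq_zero (measurableSet_Ioi.prod measurableSet_Ioo) ?_
    rintro p ⟨⟨hp1, hp2⟩, hp3⟩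
    apply hg0
    by_contra hle
    exact hp3 ⟨⟨le_of_lt hp1, not_lt.1 hle⟩, Ioo_subset_Icc_self hp2⟩
  have hai := hint a hac fun p hp => by simp [ha, (hR p hp).2]
  have hbi := hint b hbc fun p hp => by simp [hb, (hR p hp).2]
  rw [Measure.volume_eq_prod, integral_add hai (hbi.const_mul _), integral_const_mul]
  have hB : ∫ p in Ioi (0 : ℝ) ×ˢ Ioo (-π) π, b p ∂(volume.prod volume) = 0 := by
    rw [setIntegral_prod _ hbi, setIntegral_eq_zero_of_forall_eq_zero]
    intro r hr
    have hr0 : r ≠ 0 := ne_of_gt hr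
    have hder : ∀ θ : ℝ, HasDerivAt (fun θ => U (P (r, θ))) (r • b (r, θ)) θ := by
      intro θ
      have h1 : HasDerivAt (fun θ => P (r, θ)) (r * -Real.sin θ, r * Real.cos θ) θ :=
        (((Real.hasDerivAt_cos θ).const_mul r).prodMk ((Real.hasDerivAt_sin θ).const_mul r)).const_add z
      have h2 := (hdiff (P (r, θ))).hasFDerivAt.comp_hasDerivAt θ h1
      rw [show (r * -Real.sin θ, r * Real.cos θ) = r • (-Real.sin θ, Real.cos θ) from rfl,
        map_smul] at h2
      exact h2
    have hFTC := intervalIntegral.integral_eq_sub_of_hasDerivAt (a := -π) (b := π) (fun θ _ => hder θ)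
      (Continuous.intervalIntegrable (by fun_prop) _ _)
    rw [intervalIntegral.integral_smul, show P (r, π) = P (r, -π) by simp [hP], sub_self,
      smul_eq_zero, or_iff_right hr0, intervalIntegral.integral_of_le (by linarith [Real.pi_pos]),
      integral_Ioc_eq_integral_Ioo] at hFTC
    exact hFTC
  have hA : ∫ p in Ioi (0 : ℝ) ×ˢ Ioo (-π) π, a p ∂(volume.prod volume) = -(2 * π) * U z := by
    rw [setIntegral_prod _ hai]
    have hai' : Integrable (Function.uncurry fun r θ => a (r, θ))
        ((volume.restrict (Ioi 0)).prod (volume.restrict (Ioo (-π) π))) := by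
      rw [Measure.prod_restrict]; exact hai
    rw [integral_integral_swap hai']
    have : ∀ θ, ∫ r in Ioi (0 : ℝ), a (r, θ) = - U z := by
      intro θ
      have hder : ∀ r : ℝ, HasDerivAt (fun r => U (P (r, θ))) (a (r, θ)) r := by
        intro r
        have h1 : HasDerivAt (fun r => P (r, θ)) (1 * Real.cos θ, 1 * Real.sin θ) r :=
          (((hasDerivAt_id' r).mul_const (Real.cos θ)).prodMk
            ((hasDerivAt_id' r).mul_const (Real.sin θ))).const_add z
        have h2 := (hdiff (P (r, θ))).hasFDerivAt.comp_hasDerivAt r h1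
        rw [one_mul, one_mul] at h2
        exact h2
      have hlim : Tendsto (fun r => U (P (r, θ))) atTop (nhds 0) := by
        refine tendsto_const_nhds.congr' ?_
        filter_upwards [eventually_gt_atTop R] with r hr
        exact (hR (r, θ) hr).1.symm
      have hii : IntegrableOn (fun r => a (r, θ)) (Ioi 0) := by
        have h1 : IntegrableOn (fun r => a (r, θ)) (Icc 0 R) :=
          (by fun_prop : Continuous fun r => a (r, θ)).continuousOn.integrableOn_compact isCompact_Icc
        refine h1.of_forall_sdiff_eq_zero measurableSet_Ioi ?_
        rintro r ⟨hr, hr'⟩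
        simp only [ha]
        rw [(hR (r, θ) (not_le.1 fun h => hr' ⟨le_of_lt hr, h⟩)).2]
        rfl
      rw [integral_Ioi_of_hasDerivAt_of_tendsto' (fun r _ => hder r) hii hlim]
      simp [hP, ← Prod.zero_eq_mk]
    have hvol : (volume : Measure ℝ).real (Ioo (-π) π) = 2 * π := by
      rw [Real.volume_real_Ioo_of_le (by linarith [Real.pi_pos])]
      ring
    simp only [this, integral_const]
    rw [Complex.real_smul, measureReal_restrict_apply_univ, hvol]
    push_cast
    ring
  rw [hA, hB]
  simp

/-- The operator `∂ₓ + i ∂_y`. -/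
noncomputable def dbar (U : ℝ × ℝ → ℂ) (w : ℝ × ℝ) : ℂ :=
  fderiv ℝ U w (1, 0) + Complex.I * fderiv ℝ U w (0, 1)

theorem integrable_dbar_div {U : ℝ × ℝ → ℂ} (hU : ContDiff ℝ 1 U) (hc : HasCompactSupport U)
    (z : ℝ × ℝ) : Integrable fun w => dbar U w / toC (w - z) := by
  have hfd : Continuous (fderiv ℝ U) := hU.continuous_fderiv one_ne_zero
  have hD : Continuous (dbar U) := by unfold dbar; fun_prop
  have hDc : HasCompactSupport (dbar U) := by
    refine (hc.fderiv ℝ).mono ?_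
    intro w hw h
    simp only [Function.mem_support, dbar] at hw h
    simp [h] at hw
  obtain ⟨M, hM⟩ := hDc.exists_bound_of_continuous hD
  obtain ⟨R, hR⟩ := hDc.isCompact.isBounded.subset_ball 0
  obtain ⟨C, hC, hCb⟩ := lintegral_riesz_ball_zero 1 (by norm_num) (by norm_num)
  refine ⟨(hD.measurable.div (by fun_prop)).aestronglyMeasurable, ?_⟩
  rw [hasFiniteIntegral_iff_enorm]
  have hle : ∀ w, ‖dbar U w / toC (w - z)‖ₑ ≤
      (Metric.ball 0 (max R 1)).indicator (fun w => ENNReal.ofReal M * ‖z - w‖ₑ ^ (-1 : ℝ)) w := by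
    intro w
    by_cases hw : w ∈ Metric.ball (0 : ℝ × ℝ) (max R 1)
    · rw [indicator_of_mem hw]
      by_cases hwz : w = z
      · simp [hwz]
      · have h0 : toC (w - z) ≠ 0 := toC_ne_zero (sub_ne_zero.2 hwz)
        rw [div_eq_mul_inv, enorm_mul, enorm_inv h0, ENNReal.rpow_neg_one]
        gcongr
        · rw [← ofReal_norm]
          exact ENNReal.ofReal_le_ofReal (hM w)
        · rw [← ofReal_norm, ← ofReal_norm, norm_sub_rev]
          exact ENNReal.ofReal_le_ofReal (norm_le_norm_toC _)
    · rw [image_eq_zero_of_notMem_tsupport (f := dbar U)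
        (fun h => hw (Metric.ball_subset_ball (le_max_left _ _) (hR h)))]
      simp
  refine (lintegral_mono hle).trans_lt ?_
  rw [lintegral_indicator Metric.isOpen_ball.measurableSet, lintegral_const_mul' _ _ (by simp)]
  exact ENNReal.mul_lt_top (by simp) ((hCb z _ (by positivity)).trans_lt
    (ENNReal.mul_lt_top hC.lt_top (by simp)))

theorem angular_le_potential {U : ℝ × ℝ → ℂ} (hU : ContDiff ℝ 1 U) (hc : HasCompactSupport U)
    (hcirc : ∀ r : ℝ, 0 < r →
      ∫ θ in (-π)..π, (dbar U (r * Real.cos θ, r * Real.sin θ)).im = 0) (z : ℝ × ℝ) :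
    ENNReal.ofReal (2 * π * |(toC z * U z).im|) ≤
      ∫⁻ w, ‖dbar U w‖ₑ * (min ‖toC z‖ₑ ‖toC w‖ₑ * ‖z - w‖ₑ ^ (-1 : ℝ)) := by
  have hfd : Continuous (fderiv ℝ U) := hU.continuous_fderiv one_ne_zero
  have hD : Continuous (dbar U) := by unfold dbar; fun_prop
  have hmeas : MeasurableSet {w : ℝ × ℝ | ‖toC w‖ < ‖toC z‖} :=
    measurableSet_lt (by fun_prop) measurable_const
  have hDc : HasCompactSupport (dbar U) := by
    refine (hc.fderiv ℝ).mono ?_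
    intro w hw h
    simp only [Function.mem_support, dbar] at hw h
    simp [h] at hw
  have hDi : Integrable (dbar U) := hD.integrable_of_hasCompactSupport hDc
  set K : ℝ × ℝ → ℂ := fun w => -toC z * (dbar U w / toC (w - z)) with hK
  set H : ℝ × ℝ → ℂ := {w | ‖toC w‖ < ‖toC z‖}.indicator (dbar U) with hHdef
  have hKi : Integrable K := (integrable_dbar_div hU hc z).const_mul _
  have hHi : Integrable H := hDi.indicator hmeas
  have hKe : ∫ w, K w = 2 * π * (toC z * U z) := by
    have := cauchy_pompeiu hU hc z
    rw [hK, integral_const_mul]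
    unfold dbar
    rw [this]
    ring
  have hHe : (∫ w, H w).im = 0 := by
    rw [hHdef, integral_indicator hmeas]
    have := integral_im (𝕜 := ℂ) hDi.integrableOn (μ := volume.restrict {w | ‖toC w‖ < ‖toC z‖})
    refine this.symm.trans ?_
    exact integral_disk_eq_zero (Complex.continuous_im.comp hD) _ fun r hr _ => hcirc r hr
  have hKH : (∫ w, (K w - H w)).im = 2 * π * (toC z * U z).im := by
    rw [integral_sub hKi hHi, Complex.sub_im, hHe, hKe, sub_zero,
      show (2 * π : ℂ) = ((2 * π : ℝ) : ℂ) by push_cast; rfl, Complex.im_ofReal_mul]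
  have h1 : ENNReal.ofReal (2 * π * |(toC z * U z).im|) ≤ ‖∫ w, (K w - H w)‖ₑ := by
    rw [← ofReal_norm]
    refine ENNReal.ofReal_le_ofReal (le_trans (le_of_eq ?_) (Complex.abs_im_le_norm _))
    rw [hKH, abs_mul (2 * π), abs_of_pos (by positivity : 0 < 2 * π)]
  refine h1.trans ((enorm_integral_le_lintegral_enorm _).trans (lintegral_mono fun w => ?_))
  by_cases hwz : w = z
  · simp [hK, hHdef, hwz]
  have h0 : toC (z - w) ≠ 0 := toC_ne_zero (sub_ne_zero.2 (Ne.symm hwz))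
  have h2 : toC (w - z) = - toC (z - w) := by rw [← map_neg, neg_sub]
  have h3 : toC (z - w) = toC z - toC w := map_sub _ _ _
  have h4 : ‖(toC (z - w))⁻¹‖ₑ ≤ ‖z - w‖ₑ ^ (-1 : ℝ) := by
    rw [enorm_inv h0, ENNReal.rpow_neg_one, ENNReal.inv_le_inv, ← ofReal_norm, ← ofReal_norm]
    exact ENNReal.ofReal_le_ofReal (norm_le_norm_toC _)
  by_cases hlt : ‖toC w‖ < ‖toC z‖
  · have h5 : K w - H w = dbar U w * (toC w * (toC (z - w))⁻¹) := by
      simp only [hK, hHdef]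
      rw [indicator_of_mem (by exact hlt), h2]
      field_simp
      rw [h3]
      ring
    have h6 : ‖toC w‖ₑ ≤ ‖toC z‖ₑ := by
      rw [← ofReal_norm, ← ofReal_norm]; exact ENNReal.ofReal_le_ofReal hlt.le
    rw [h5, enorm_mul, enorm_mul, min_eq_right h6]
    gcongr
  · have h5 : K w - H w = dbar U w * (toC z * (toC (z - w))⁻¹) := by
      simp only [hK, hHdef]
      rw [indicator_of_notMem (by exact hlt), h2]
      field_simp
      ring
    have h6 : ‖toC z‖ₑ ≤ ‖toC w‖ₑ := by
      rw [← ofReal_norm, ← ofReal_norm]; exact ENNReal.ofReal_le_ofReal (not_lt.1 hlt)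
    rw [h5, enorm_mul, enorm_mul, min_eq_left h6]
    gcongr

/-! ### Radial cut-offs -/

theorem exists_bound_deriv_smoothTransition :
    ∃ L : ℝ, 0 ≤ L ∧ ∀ t, |deriv Real.smoothTransition t| ≤ (Iic (1 : ℝ)).indicator (fun _ => L) t := by
  have hc : Continuous (deriv Real.smoothTransition) :=
    (Real.smoothTransition.contDiff (n := 1)).continuous_deriv le_rfl
  obtain ⟨L, hL⟩ := (isCompact_Icc (a := (0 : ℝ)) (b := 1)).exists_bound_of_continuousOn hc.continuousOn
  have hL0 : 0 ≤ L := (norm_nonneg _).trans (hL 0 (by simp))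
  refine ⟨L, hL0, fun t => ?_⟩
  rcases lt_or_ge 1 t with h | h
  · have : Real.smoothTransition =ᶠ[nhds t] fun _ => 1 := by
      filter_upwards [lt_mem_nhds h] with s hs
      exact Real.smoothTransition.one_of_one_le hs.le
    simp [this.deriv_eq, h]
  rw [indicator_of_mem (by exact h)]
  rcases lt_or_ge t 0 with h0 | h0
  · have : Real.smoothTransition =ᶠ[nhds t] fun _ => 0 := by
      filter_upwards [gt_mem_nhds h0] with s hs
      exact Real.smoothTransition.zero_of_nonpos hs.le
    simpa [this.deriv_eq] using hL0
  · exact hL t ⟨h0, h⟩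

/-- A smooth function equal to `1` on `[2 a, b]` and to `0` outside `[a, 2 b]`. -/
noncomputable def cutoff (a b t : ℝ) : ℝ :=
  Real.smoothTransition (t / a - 1) * (1 - Real.smoothTransition (t / b - 1))

theorem contDiff_cutoff (a b : ℝ) : ContDiff ℝ (⊤ : ℕ∞) (cutoff a b) := by
  unfold cutoff
  have h : ContDiff ℝ (⊤ : ℕ∞) Real.smoothTransition := Real.smoothTransition.contDiff
  exact (h.comp (by fun_prop)).mul (contDiff_const.sub (h.comp (by fun_prop)))

theorem cutoff_nonneg (a b t : ℝ) : 0 ≤ cutoff a b t :=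
  mul_nonneg (Real.smoothTransition.nonneg _) (sub_nonneg.2 (Real.smoothTransition.le_one _))

theorem cutoff_le_one (a b t : ℝ) : cutoff a b t ≤ 1 :=
  mul_le_one₀ (Real.smoothTransition.le_one _) (sub_nonneg.2 (Real.smoothTransition.le_one _))
    (sub_le_self _ (Real.smoothTransition.nonneg _))

theorem cutoff_eq_zero_of_le {a b t : ℝ} (ha : 0 < a) (h : t ≤ a) : cutoff a b t = 0 := by
  rw [cutoff, Real.smoothTransition.zero_of_nonpos, zero_mul]
  rw [sub_nonpos, div_le_one ha]
  exact h

theorem cutoff_eq_zero_of_ge {a b t : ℝ} (hb : 0 < b) (h : 2 * b ≤ t) : cutoff a b t = 0 := by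
  rw [cutoff, Real.smoothTransition.one_of_one_le (x := t / b - 1), sub_self, mul_zero]
  rw [le_sub_iff_add_le, le_div_iff₀ hb]
  linarith

theorem cutoff_eq_one {a b t : ℝ} (ha : 0 < a) (hb : 0 < b) (h : 2 * a ≤ t) (h' : t ≤ b) :
    cutoff a b t = 1 := by
  rw [cutoff, Real.smoothTransition.one_of_one_le, Real.smoothTransition.zero_of_nonpos]
  · norm_num
  · rw [sub_nonpos, div_le_one hb]
    exact h'
  · rw [le_sub_iff_add_le, le_div_iff₀ ha]
    linarith

theorem exists_bound_deriv_cutoff : ∃ L : ℝ, 0 ≤ L ∧ ∀ a b t, 0 < a → 0 < b →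
    |deriv (cutoff a b) t| ≤ (Iic (2 * a)).indicator (fun _ => L / a) t +
      (Iic (2 * b)).indicator (fun _ => L / b) t := by
  obtain ⟨L, hL0, hL⟩ := exists_bound_deriv_smoothTransition
  refine ⟨L, hL0, fun a b t ha hb => ?_⟩
  have hS : Differentiable ℝ Real.smoothTransition :=
    (Real.smoothTransition.contDiff (n := 1)).differentiable one_ne_zero
  have hd : ∀ c : ℝ, HasDerivAt (fun t => Real.smoothTransition (t / c - 1))
      (deriv Real.smoothTransition (t / c - 1) * (1 / c)) t := fun c =>
    (hS _).hasDerivAt.comp t (((hasDerivAt_id' t).div_const c).sub_const 1)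
  have hk : ∀ c : ℝ, 0 < c → |deriv Real.smoothTransition (t / c - 1) * (1 / c)| ≤
      (Iic (2 * c)).indicator (fun _ => L / c) t := by
    intro c hc
    rw [abs_mul, abs_of_pos (by positivity : 0 < 1 / c)]
    have h := hL (t / c - 1)
    have hiff : t / c - 1 ≤ 1 ↔ t ≤ 2 * c := by
      rw [sub_le_iff_le_add, div_le_iff₀ hc]
      norm_num
    by_cases hle : t ≤ 2 * c
    · rw [indicator_of_mem (by exact hiff.2 hle)] at h
      rw [indicator_of_mem (by exact hle), div_eq_mul_one_div L c]
      exact mul_le_mul_of_nonneg_right h (by positivity)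
    · rw [indicator_of_notMem (fun h' : t / c - 1 ∈ Iic (1 : ℝ) => hle (hiff.1 h'))] at h
      rw [indicator_of_notMem (by exact hle), le_antisymm h (abs_nonneg _), zero_mul]
  have hder : deriv (cutoff a b) t = deriv Real.smoothTransition (t / a - 1) * (1 / a) *
      (1 - Real.smoothTransition (t / b - 1)) + Real.smoothTransition (t / a - 1) *
      -(deriv Real.smoothTransition (t / b - 1) * (1 / b)) :=
    ((hd a).mul ((hd b).const_sub 1)).deriv
  rw [hder]
  refine (abs_add_le _ _).trans (add_le_add ?_ ?_)
  · rw [abs_mul]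
    refine (mul_le_of_le_one_right (abs_nonneg _) ?_).trans (hk a ha)
    rw [abs_of_nonneg (sub_nonneg.2 (Real.smoothTransition.le_one _))]
    exact sub_le_self _ (Real.smoothTransition.nonneg _)
  · rw [abs_mul, abs_neg]
    refine (mul_le_of_le_one_left (abs_nonneg _) ?_).trans (hk b hb)
    rw [abs_of_nonneg (Real.smoothTransition.nonneg _)]
    exact Real.smoothTransition.le_one _

/-! ### The localised complex gradient -/

section ComplexGradient

variable {n : ℕ}

/-- The complex gradient `∂ₓg - i ∂_y g` of `g = ⟪e, f⟫`, multiplied by a radial cut-off. -/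
noncomputable def cutGrad (χ : ℝ → ℝ) (e : EuclideanSpace ℝ (Fin n))
    (f : ℝ × ℝ → EuclideanSpace ℝ (Fin n)) (w : ℝ × ℝ) : ℂ :=
  ((χ (w.1 ^ 2 + w.2 ^ 2) * ⟪e, pd1 f w⟫ : ℝ) : ℂ) -
    Complex.I * ((χ (w.1 ^ 2 + w.2 ^ 2) * ⟪e, pd2 f w⟫ : ℝ) : ℂ)

theorem dbar_cutGrad_of_contDiffAt {χ : ℝ → ℝ} (hχ : ContDiff ℝ (⊤ : ℕ∞) χ)
    (e : EuclideanSpace ℝ (Fin n)) {f : ℝ × ℝ → EuclideanSpace ℝ (Fin n)} {w : ℝ × ℝ}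
    (hf : ContDiffAt ℝ (⊤ : ℕ∞) f w) :
    dbar (cutGrad χ e f) w = ((χ (w.1 ^ 2 + w.2 ^ 2) * ⟪e, lap f w⟫ : ℝ) : ℂ) +
      ((2 * deriv χ (w.1 ^ 2 + w.2 ^ 2) : ℝ) : ℂ) * toC w *
        ((⟪e, pd1 f w⟫ : ℝ) - Complex.I * (⟪e, pd2 f w⟫ : ℝ)) := by
  have hff : ContDiffAt ℝ 1 (fderiv ℝ f) w := hf.fderiv_right (WithTop.coe_le_coe.2 (le_top (a := 1 + 1)))
  have hB := (hff.differentiableAt one_ne_zero).hasFDerivAt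
  have hsymm : IsSymmSndFDerivAt ℝ f w := hf.isSymmSndFDerivAt (by
    rw [minSmoothness_of_isRCLikeNormedField]
    exact WithTop.coe_le_coe.2 (le_top (a := 2)))
  set B := fderiv ℝ (fderiv ℝ f) w with hBdef
  have hpd : ∀ v : ℝ × ℝ, HasFDerivAt (fun w => fderiv ℝ f w v) (B.flip v) w := fun v =>
    (hB.clm_apply (hasFDerivAt_const v w)).congr_fderiv (by simp)
  have h1 : HasFDerivAt (pd1 f) (B.flip (1, 0)) w := hpd (1, 0)
  have h2 : HasFDerivAt (pd2 f) (B.flip (0, 1)) w := hpd (0, 1)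
  have hlap : lap f w = B (1, 0) (1, 0) + B (0, 1) (0, 1) := by
    rw [lap, pd1, pd2, h1.fderiv, h2.fderiv]
    rfl
  have hN : HasFDerivAt (fun w : ℝ × ℝ => w.1 ^ 2 + w.2 ^ 2)
      ((2 * w.1) • ContinuousLinearMap.fst ℝ ℝ ℝ + (2 * w.2) • ContinuousLinearMap.snd ℝ ℝ ℝ) w :=
    ((hasFDerivAt_fst.pow 2).add (hasFDerivAt_snd.pow 2)).congr_fderiv (by ext <;> simp)
  have hφ := ((hχ.differentiable (by simp)) (w.1 ^ 2 + w.2 ^ 2)).hasDerivAt.comp_hasFDerivAt w hN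
  have hg : ∀ v : ℝ × ℝ, HasFDerivAt (fun w => (⟪e, fderiv ℝ f w v⟫ : ℝ))
      ((innerSL ℝ e).comp (B.flip v)) w := fun v =>
    ((innerSL ℝ e).hasFDerivAt).comp w (hpd v)
  have hU := (Complex.ofRealCLM.hasFDerivAt.comp w (hφ.mul (hg (1, 0)))).sub
    ((Complex.ofRealCLM.hasFDerivAt.comp w (hφ.mul (hg (0, 1)))).const_mul Complex.I)
  have hU' : fderiv ℝ (cutGrad χ e f) w = _ := HasFDerivAt.fderiv hU
  have hs : B (1, 0) (0, 1) = B (0, 1) (1, 0) := hsymm _ _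
  rw [dbar, hU', hlap]
  apply Complex.ext
  · simp [pd1, pd2, inner_add_right]
    ring
  · simp [pd1, pd2, hs]
    ring

variable {χ : ℝ → ℝ} {a b : ℝ} {f : ℝ × ℝ → EuclideanSpace ℝ (Fin n)}

theorem eventually_cutoff_eq_zero (hca : ∀ t ≤ a, χ t = 0) (hcb : ∀ t, b ≤ t → χ t = 0)
    (ha : 0 < a) (hb : b < 1) {w : ℝ × ℝ} (hw : w ∉ disk 1 \ {0}) :
    ∀ᶠ t in nhds (w.1 ^ 2 + w.2 ^ 2), χ t = 0 := by
  by_cases h : w.1 ^ 2 + w.2 ^ 2 < 1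
  · have h0 : w = 0 := by
      by_contra h0
      exact hw ⟨by simpa [disk] using h, h0⟩
    filter_upwards [gt_mem_nhds (show w.1 ^ 2 + w.2 ^ 2 < a by simpa [h0] using ha)] with t ht
    exact hca t ht.le
  · filter_upwards [lt_mem_nhds (hb.trans_le (not_lt.1 h))] with t ht
    exact hcb t ht.le

theorem isOpen_disk (r : ℝ) : IsOpen (disk r) :=
  isOpen_lt (by fun_prop) continuous_const

theorem ContDiffOn.contDiffAt_punctured (hsm : ContDiffOn ℝ (⊤ : ℕ∞) f (disk 1 \ {0}))
    {w : ℝ × ℝ} (hw : w ∈ disk 1 \ {0}) : ContDiffAt ℝ (⊤ : ℕ∞) f w :=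
  hsm.contDiffAt (((isOpen_disk 1).sdiff isClosed_singleton).mem_nhds hw)

theorem cutGrad_eventuallyEq_zero (hca : ∀ t ≤ a, χ t = 0) (hcb : ∀ t, b ≤ t → χ t = 0)
    (ha : 0 < a) (hb : b < 1) (e : EuclideanSpace ℝ (Fin n)) {w : ℝ × ℝ} (hw : w ∉ disk 1 \ {0}) :
    cutGrad χ e f =ᶠ[nhds w] fun _ => 0 := by
  have h := (by fun_prop : Continuous fun w : ℝ × ℝ => w.1 ^ 2 + w.2 ^ 2).continuousAt.eventually
    (eventually_cutoff_eq_zero hca hcb ha hb hw)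
  filter_upwards [h] with v hv
  simp [cutGrad, hv]

theorem contDiff_cutGrad (hχ : ContDiff ℝ (⊤ : ℕ∞) χ) (hca : ∀ t ≤ a, χ t = 0)
    (hcb : ∀ t, b ≤ t → χ t = 0) (ha : 0 < a) (hb : b < 1)
    (hsm : ContDiffOn ℝ (⊤ : ℕ∞) f (disk 1 \ {0})) (e : EuclideanSpace ℝ (Fin n)) :
    ContDiff ℝ 1 (cutGrad χ e f) := by
  rw [contDiff_iff_contDiffAt]
  intro w
  by_cases hw : w ∈ disk 1 \ {0}
  · have hff : ContDiffAt ℝ 1 (fderiv ℝ f) w :=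
      (hsm.contDiffAt_punctured hw).fderiv_right (WithTop.coe_le_coe.2 (le_top (a := 1 + 1)))
    have hφ : ContDiffAt ℝ 1 (fun w : ℝ × ℝ => χ (w.1 ^ 2 + w.2 ^ 2)) w :=
      ((hχ.of_le (by exact_mod_cast le_top)).comp (by fun_prop)).contDiffAt
    have hg : ∀ v : ℝ × ℝ, ContDiffAt ℝ 1
        (fun w => ((χ (w.1 ^ 2 + w.2 ^ 2) * ⟪e, fderiv ℝ f w v⟫ : ℝ) : ℂ)) w := fun v =>
      Complex.ofRealCLM.contDiff.contDiffAt.comp w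
        (hφ.mul (contDiffAt_const.inner ℝ (hff.clm_apply contDiffAt_const)))
    exact (hg (1, 0)).sub (contDiffAt_const.mul (hg (0, 1)))
  · exact contDiffAt_const.congr_of_eventuallyEq (cutGrad_eventuallyEq_zero hca hcb ha hb e hw)

theorem hasCompactSupport_cutGrad (hcb : ∀ t, b ≤ t → χ t = 0) (hb : b < 1)
    (e : EuclideanSpace ℝ (Fin n)) : HasCompactSupport (cutGrad χ e f) := by
  refine HasCompactSupport.intro (isCompact_closedBall (0 : ℝ × ℝ) 1) fun w hw => ?_
  have h : b ≤ w.1 ^ 2 + w.2 ^ 2 := by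
    rw [Metric.mem_closedBall, dist_zero_right, not_le] at hw
    have h1 := norm_le_norm_toC w
    have h2 := norm_toC_sq w
    nlinarith
  simp [cutGrad, hcb _ h]

theorem dbar_cutGrad (hχ : ContDiff ℝ (⊤ : ℕ∞) χ) (hca : ∀ t ≤ a, χ t = 0)
    (hcb : ∀ t, b ≤ t → χ t = 0) (ha : 0 < a) (hb : b < 1)
    (hsm : ContDiffOn ℝ (⊤ : ℕ∞) f (disk 1 \ {0})) (e : EuclideanSpace ℝ (Fin n)) (w : ℝ × ℝ) :
    dbar (cutGrad χ e f) w = ((χ (w.1 ^ 2 + w.2 ^ 2) * ⟪e, lap f w⟫ : ℝ) : ℂ) +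
      ((2 * deriv χ (w.1 ^ 2 + w.2 ^ 2) : ℝ) : ℂ) * toC w *
        ((⟪e, pd1 f w⟫ : ℝ) - Complex.I * (⟪e, pd2 f w⟫ : ℝ)) := by
  by_cases hw : w ∈ disk 1 \ {0}
  · exact dbar_cutGrad_of_contDiffAt hχ e (hsm.contDiffAt_punctured hw)
  · have h0 := eventually_cutoff_eq_zero hca hcb ha hb hw
    have h1 : χ =ᶠ[nhds (w.1 ^ 2 + w.2 ^ 2)] fun _ => 0 := h0
    rw [dbar, (cutGrad_eventuallyEq_zero hca hcb ha hb e hw).fderiv_eq, h1.deriv_eq, h0.self_of_nhds]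
    simp

theorem integral_im_dbar_cutGrad (hχ : ContDiff ℝ (⊤ : ℕ∞) χ) (hca : ∀ t ≤ a, χ t = 0)
    (hcb : ∀ t, b ≤ t → χ t = 0) (ha : 0 < a) (hb : b < 1)
    (hsm : ContDiffOn ℝ (⊤ : ℕ∞) f (disk 1 \ {0})) (e : EuclideanSpace ℝ (Fin n))
    {r : ℝ} (hr : 0 < r) :
    ∫ θ in (-π)..π, (dbar (cutGrad χ e f) (r * Real.cos θ, r * Real.sin θ)).im = 0 := by
  have hN : ∀ θ : ℝ, (r * Real.cos θ) ^ 2 + (r * Real.sin θ) ^ 2 = r ^ 2 := fun θ => by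
    linear_combination r ^ 2 * Real.sin_sq_add_cos_sq θ
  set P : ℝ → ℝ × ℝ := fun θ => (r * Real.cos θ, r * Real.sin θ) with hP
  have him : ∀ θ, (dbar (cutGrad χ e f) (P θ)).im = -2 * deriv χ (r ^ 2) *
      ⟪e, fderiv ℝ f (P θ) (r * -Real.sin θ, r * Real.cos θ)⟫ := by
    intro θ
    rw [dbar_cutGrad hχ hca hcb ha hb hsm]
    have : ((r * -Real.sin θ, r * Real.cos θ) : ℝ × ℝ) =
        (r * -Real.sin θ) • (1, 0) + (r * Real.cos θ) • (0, 1) := by simp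
    rw [this, map_add, map_smul, map_smul, inner_add_right, inner_smul_right, inner_smul_right]
    simp only [hP, hN]
    simp [pd1, pd2]
    ring
  change ∫ θ in (-π)..π, (dbar (cutGrad χ e f) (P θ)).im = 0
  simp only [him]
  rw [intervalIntegral.integral_const_mul]
  by_cases hr1 : r < 1
  · have hmem : ∀ θ, P θ ∈ disk 1 \ {0} := by
      intro θ
      refine ⟨?_, fun h => ?_⟩
      · show (P θ).1 ^ 2 + (P θ).2 ^ 2 < 1 ^ 2
        simp only [hP, hN]
        nlinarith
      · have h1 := hN θ
        have h2 : P θ = 0 := h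
        simp only [hP, Prod.mk_eq_zero] at h2
        rw [h2.1, h2.2] at h1
        nlinarith
    have hPd : ∀ θ, HasDerivAt P (r * -Real.sin θ, r * Real.cos θ) θ := fun θ =>
      ((Real.hasDerivAt_cos θ).const_mul r).prodMk ((Real.hasDerivAt_sin θ).const_mul r)
    have hder : ∀ θ : ℝ, HasDerivAt (fun θ => (⟪e, f (P θ)⟫ : ℝ))
        ⟪e, fderiv ℝ f (P θ) (r * -Real.sin θ, r * Real.cos θ)⟫ θ := by
      intro θ
      have hfd := ((hsm.contDiffAt_punctured (hmem θ)).differentiableAt (by simp)).hasFDerivAt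
      exact ((innerSL ℝ e).hasFDerivAt).comp_hasDerivAt θ (hfd.comp_hasDerivAt θ (hPd θ))
    have hcont : Continuous fun θ => (⟪e, fderiv ℝ f (P θ) (r * -Real.sin θ, r * Real.cos θ)⟫ : ℝ) := by
      have hc : Continuous fun θ => fderiv ℝ f (P θ) := by
        rw [continuous_iff_continuousAt]
        intro θ
        exact ((hsm.contDiffAt_punctured (hmem θ)).fderiv_right (m := 0)
          (by exact_mod_cast le_top)).continuousAt.comp (hPd θ).continuousAt
      fun_prop
    rw [intervalIntegral.integral_eq_sub_of_hasDerivAt (fun θ _ => hder θ)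
      (hcont.intervalIntegrable _ _)]
    simp [hP]
  · have h0 : χ =ᶠ[nhds (r ^ 2)] fun _ => 0 := by
      filter_upwards [lt_mem_nhds (show b < r ^ 2 by nlinarith)] with t ht
      exact hcb t ht.le
    simp [h0.deriv_eq]

end ComplexGradient

section PotentialBound

variable {n : ℕ} {χ : ℝ → ℝ} {a b : ℝ} {f : ℝ × ℝ → EuclideanSpace ℝ (Fin n)}

theorem gradSq_nonneg (f : ℝ × ℝ → EuclideanSpace ℝ (Fin n)) (z : ℝ × ℝ) : 0 ≤ gradSq f z := by
  unfold gradSq; positivity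

theorem norm_toC_mul_sqrt_gradSq {z : ℝ × ℝ} (h : ‖pd1 f z‖ ^ 2 = ‖pd2 f z‖ ^ 2)
    (h' : ⟪pd1 f z, pd2 f z⟫ = 0) :
    ‖toC z‖ * √(gradSq f z) = √2 * ‖z.2 • pd1 f z - z.1 • pd2 f z‖ := by
  refine (sq_eq_sq₀ (by positivity) (by positivity)).1 ?_
  rw [mul_pow, mul_pow, Real.sq_sqrt (gradSq_nonneg f z), Real.sq_sqrt (by norm_num), norm_toC_sq,
    @norm_sub_sq_real, inner_smul_left, inner_smul_right, h', norm_smul, norm_smul, mul_pow, mul_pow,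
    gradSq, h, Real.norm_eq_abs, Real.norm_eq_abs, sq_abs, sq_abs]
  simp
  ring

theorem enorm_dbar_cutGrad_le (hχ : ContDiff ℝ (⊤ : ℕ∞) χ) (hχ0 : ∀ t, 0 ≤ χ t)
    (hca : ∀ t ≤ a, χ t = 0) (hcb : ∀ t, b ≤ t → χ t = 0) (ha : 0 < a) (hb : b < 1)
    (hsm : ContDiffOn ℝ (⊤ : ℕ∞) f (disk 1 \ {0})) {e : EuclideanSpace ℝ (Fin n)} (he : ‖e‖ = 1)
    (w : ℝ × ℝ) :
    ‖dbar (cutGrad χ e f) w‖ₑ ≤ ENNReal.ofReal (χ (w.1 ^ 2 + w.2 ^ 2)) * ‖lap f w‖ₑ +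
      ENNReal.ofReal (2 * |deriv χ (w.1 ^ 2 + w.2 ^ 2)| * ‖toC w‖ * √(gradSq f w)) := by
  have hin : ∀ v : EuclideanSpace ℝ (Fin n), |(⟪e, v⟫ : ℝ)| ≤ ‖v‖ := fun v => by
    simpa [he] using abs_real_inner_le_norm e v
  rw [dbar_cutGrad hχ hca hcb ha hb hsm]
  refine (enorm_add_le _ _).trans (add_le_add ?_ ?_)
  · rw [← ofReal_norm, ← ofReal_norm, ← ENNReal.ofReal_mul (hχ0 _), Complex.norm_real,
      Real.norm_eq_abs, abs_mul, abs_of_nonneg (hχ0 _)]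
    exact ENNReal.ofReal_le_ofReal (mul_le_mul_of_nonneg_left (hin _) (hχ0 _))
  · rw [← ofReal_norm, norm_mul, norm_mul, Complex.norm_real, Real.norm_eq_abs, abs_mul, abs_two]
    refine ENNReal.ofReal_le_ofReal (mul_le_mul_of_nonneg_left ?_ (by positivity))
    refine Real.le_sqrt_of_sq_le ?_
    rw [Complex.sq_norm, Complex.normSq_apply, gradSq]
    have h1 := sq_le_sq.2 ((hin (pd1 f w)).trans (le_abs_self _))
    have h2 := sq_le_sq.2 ((hin (pd2 f w)).trans (le_abs_self _))
    simp
    linarith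

theorem cutoff_mul_sqrt_gradSq_le_potential (hχ : ContDiff ℝ (⊤ : ℕ∞) χ) (hχ0 : ∀ t, 0 ≤ χ t)
    (hca : ∀ t ≤ a, χ t = 0) (hcb : ∀ t, b ≤ t → χ t = 0) (ha : 0 < a) (hb : b < 1)
    (hsm : ContDiffOn ℝ (⊤ : ℕ∞) f (disk 1 \ {0})) {z : ℝ × ℝ}
    (h : ‖pd1 f z‖ ^ 2 = ‖pd2 f z‖ ^ 2) (h' : ⟪pd1 f z, pd2 f z⟫ = 0) :
    ENNReal.ofReal (‖toC z‖ * (χ (z.1 ^ 2 + z.2 ^ 2) * √(gradSq f z))) ≤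
      ∫⁻ w, (ENNReal.ofReal (χ (w.1 ^ 2 + w.2 ^ 2)) * ‖lap f w‖ₑ +
        ENNReal.ofReal (2 * |deriv χ (w.1 ^ 2 + w.2 ^ 2)| * ‖toC w‖ * √(gradSq f w))) *
        (min ‖toC z‖ₑ ‖toC w‖ₑ * ‖z - w‖ₑ ^ (-1 : ℝ)) := by
  rw [mul_left_comm, norm_toC_mul_sqrt_gradSq h h']
  set v := z.2 • pd1 f z - z.1 • pd2 f z with hv
  by_cases hv0 : v = 0
  · simp [hv0]
  have hvn : ‖v‖ ≠ 0 := norm_ne_zero_iff.2 hv0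
  set e : EuclideanSpace ℝ (Fin n) := ‖v‖⁻¹ • v with he
  have he1 : ‖e‖ = 1 := by
    rw [he, norm_smul, norm_inv, norm_norm, inv_mul_cancel₀ hvn]
  have hev : (⟪e, v⟫ : ℝ) = ‖v‖ := by
    rw [he, inner_smul_left, real_inner_self_eq_norm_sq]
    simp only [conj_trivial]
    field_simp
  have him : (toC z * cutGrad χ e f z).im = χ (z.1 ^ 2 + z.2 ^ 2) * ‖v‖ := by
    rw [← hev, hv, inner_sub_right, inner_smul_right, inner_smul_right]
    simp [cutGrad]
    ring
  have key := angular_le_potential (contDiff_cutGrad hχ hca hcb ha hb hsm e)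
    (hasCompactSupport_cutGrad hcb hb e)
    (fun r hr => integral_im_dbar_cutGrad hχ hca hcb ha hb hsm e hr) z
  rw [him] at key
  refine le_trans (ENNReal.ofReal_le_ofReal ?_) (key.trans (lintegral_mono fun w =>
    mul_le_mul_left (enorm_dbar_cutGrad_le hχ hχ0 hca hcb ha hb hsm he1 w) _))
  have h2 : √2 ≤ 2 * π := by
    rw [Real.sqrt_le_left (by positivity)]
    nlinarith [Real.pi_gt_three]
  have h3 : 0 ≤ χ (z.1 ^ 2 + z.2 ^ 2) * ‖v‖ := mul_nonneg (hχ0 _) (norm_nonneg _)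
  rw [abs_of_nonneg h3, mul_left_comm]
  exact mul_le_mul_of_nonneg_right h2 h3

end PotentialBound

section WeightedBound

/-- A weight vanishing linearly at the origin and equal to `1` away from it. -/
noncomputable def weight (δ : ℝ) (z : ℝ × ℝ) : ℝ≥0∞ := min 1 (‖toC z‖ₑ / ENNReal.ofReal δ)

theorem weight_mul_min_le (δ : ℝ) (z w : ℝ × ℝ) :
    weight δ z * min ‖toC z‖ₑ ‖toC w‖ₑ ≤ weight δ w * ‖toC z‖ₑ := by
  unfold weight
  rcases le_total ‖toC z‖ₑ ‖toC w‖ₑ with h | h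
  · rw [min_eq_left h]
    gcongr
  · rw [min_eq_right h]
    rcases min_choice 1 (‖toC w‖ₑ / ENNReal.ofReal δ) with h1 | h1 <;> rw [h1]
    · exact mul_le_mul' (min_le_left _ _) h
    · refine (mul_le_mul_left (min_le_right _ _) _).trans (le_of_eq ?_)
      rw [div_eq_mul_inv, div_eq_mul_inv]
      ring

variable {n : ℕ} {χ : ℝ → ℝ} {a b : ℝ} {f : ℝ × ℝ → EuclideanSpace ℝ (Fin n)}

theorem cutoff_eq_zero_of_notMem (hca : ∀ t ≤ a, χ t = 0) (ha : 0 < a) {r : ℝ}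
    (hcr : ∀ t, r ^ 2 ≤ t → χ t = 0) {w : ℝ × ℝ} (hw : w ∉ disk r \ {0}) :
    χ (w.1 ^ 2 + w.2 ^ 2) = 0 := by
  by_cases h : w.1 ^ 2 + w.2 ^ 2 < r ^ 2
  · have h0 : w = 0 := by
      by_contra h0
      exact hw ⟨h, h0⟩
    exact hca _ (by simpa [h0] using ha.le)
  · exact hcr _ (not_lt.1 h)

/-- The ratio `|Δf| / |∇f|` on the punctured disk of radius `r`, extended by zero. -/
noncomputable def curvatureRatio (f : ℝ × ℝ → EuclideanSpace ℝ (Fin n)) (r : ℝ) : ℝ × ℝ → ℝ≥0∞ :=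
  ((disk r \ {0}) ∩ {w | gradSq f w ≠ 0}).indicator
    fun w => ‖lap f w‖ₑ / ENNReal.ofReal √(gradSq f w)

theorem mul_enorm_lap_le (hca : ∀ t ≤ a, χ t = 0) (ha : 0 < a) {r : ℝ} (hr0 : 0 ≤ r) (hr : r ≤ 1)
    (hcr : ∀ t, r ^ 2 ≤ t → χ t = 0)
    (hH : ∀ z ∈ disk 1 \ {0}, fderiv ℝ f z = 0 → lap f z = 0) (w : ℝ × ℝ) :
    ENNReal.ofReal (χ (w.1 ^ 2 + w.2 ^ 2)) * ‖lap f w‖ₑ ≤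
      curvatureRatio f r w * ENNReal.ofReal (χ (w.1 ^ 2 + w.2 ^ 2) * √(gradSq f w)) := by
  by_cases hw : w ∈ disk r \ {0}
  swap
  · simp [cutoff_eq_zero_of_notMem hca ha hcr hw]
  by_cases hg : gradSq f w = 0
  · have h1 : fderiv ℝ f w = 0 := by
      unfold gradSq pd1 pd2 at hg
      have h2 : fderiv ℝ f w (1, 0) = 0 := by
        rw [← norm_eq_zero]; nlinarith [sq_nonneg ‖fderiv ℝ f w (1, 0)‖, sq_nonneg ‖fderiv ℝ f w (0, 1)‖]
      have h3 : fderiv ℝ f w (0, 1) = 0 := by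
        rw [← norm_eq_zero]; nlinarith [sq_nonneg ‖fderiv ℝ f w (1, 0)‖, sq_nonneg ‖fderiv ℝ f w (0, 1)‖]
      ext1
      · ext1; simp [h2]
      · ext1; simp [h3]
    have h2 : w.1 ^ 2 + w.2 ^ 2 < r ^ 2 := hw.1
    have h3 : w ∈ disk 1 \ {0} := ⟨show w.1 ^ 2 + w.2 ^ 2 < 1 ^ 2 by nlinarith, hw.2⟩
    simp [hH w h3 h1]
  · have hpos : 0 < √(gradSq f w) := Real.sqrt_pos.2 ((gradSq_nonneg f w).lt_of_ne' hg)
    rw [curvatureRatio, indicator_of_mem (show w ∈ (disk r \ {0}) ∩ {w | gradSq f w ≠ 0} from ⟨hw, hg⟩), ENNReal.ofReal_mul' hpos.le, mul_left_comm,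
      ENNReal.div_mul_cancel (by simpa using hpos) ENNReal.ofReal_ne_top]

theorem weight_mul_cutoff_le_potential (hχ : ContDiff ℝ (⊤ : ℕ∞) χ) (hχ0 : ∀ t, 0 ≤ χ t)
    (hca : ∀ t ≤ a, χ t = 0) (ha : 0 < a) {r : ℝ} (hr0 : 0 ≤ r) (hr : r ≤ 1)
    (hcb : ∀ t, b ≤ t → χ t = 0) (hbr : b ≤ r ^ 2) (hb : b < 1)
    (hsm : ContDiffOn ℝ (⊤ : ℕ∞) f (disk 1 \ {0}))
    (hconf : ∀ z ∈ disk 1 \ {0}, ‖pd1 f z‖ ^ 2 = ‖pd2 f z‖ ^ 2 ∧ ⟪pd1 f z, pd2 f z⟫ = 0)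
    (hH : ∀ z ∈ disk 1 \ {0}, fderiv ℝ f z = 0 → lap f z = 0) (δ : ℝ) (z : ℝ × ℝ) :
    weight δ z * ENNReal.ofReal (χ (z.1 ^ 2 + z.2 ^ 2) * √(gradSq f z)) ≤
      ∫⁻ w, (curvatureRatio f r w *
          (weight δ w * ENNReal.ofReal (χ (w.1 ^ 2 + w.2 ^ 2) * √(gradSq f w))) +
        weight δ w *
          ENNReal.ofReal (2 * |deriv χ (w.1 ^ 2 + w.2 ^ 2)| * ‖toC w‖ * √(gradSq f w))) *
        ‖z - w‖ₑ ^ (-1 : ℝ) := by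
  by_cases hz : z ∈ disk 1 \ {0}
  swap
  · simp [cutoff_eq_zero_of_notMem hca ha (r := 1) (fun t ht => hcb t (by linarith)) hz]
  have hz0 : ‖toC z‖ₑ ≠ 0 := enorm_ne_zero.2 (toC_ne_zero hz.2)
  rw [← ENNReal.mul_le_mul_iff_right hz0 enorm_ne_top, mul_left_comm, ← ofReal_norm,
    ← ENNReal.ofReal_mul (norm_nonneg _), ofReal_norm]
  refine (mul_le_mul_right (cutoff_mul_sqrt_gradSq_le_potential hχ hχ0 hca hcb ha hb hsm
    (hconf z hz).1 (hconf z hz).2) _).trans ?_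
  have hw : weight δ z ≠ ⊤ := ne_top_of_le_ne_top ENNReal.one_ne_top (min_le_left _ _)
  rw [← lintegral_const_mul' _ _ hw, ← lintegral_const_mul' _ _ enorm_ne_top]
  refine lintegral_mono fun w => ?_
  set k := ‖z - w‖ₑ ^ (-1 : ℝ)
  set β := ENNReal.ofReal (2 * |deriv χ (w.1 ^ 2 + w.2 ^ 2)| * ‖toC w‖ * √(gradSq f w))
  have h1 := mul_enorm_lap_le (f := f) hca ha hr0 hr (fun t ht => hcb t (hbr.trans ht)) hH w
  calc weight δ z * ((ENNReal.ofReal (χ (w.1 ^ 2 + w.2 ^ 2)) * ‖lap f w‖ₑ + β) *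
        (min ‖toC z‖ₑ ‖toC w‖ₑ * k))
      = (ENNReal.ofReal (χ (w.1 ^ 2 + w.2 ^ 2)) * ‖lap f w‖ₑ + β) *
        ((weight δ z * min ‖toC z‖ₑ ‖toC w‖ₑ) * k) := by ring
    _ ≤ (curvatureRatio f r w * ENNReal.ofReal (χ (w.1 ^ 2 + w.2 ^ 2) * √(gradSq f w)) + β) *
        ((weight δ w * ‖toC z‖ₑ) * k) := by
        gcongr ?_ * (?_ * k)
        · gcongr
        · exact weight_mul_min_le δ z w
    _ = _ := by ring

end WeightedBound

section Estimates

variable {n : ℕ} (f : ℝ × ℝ → EuclideanSpace ℝ (Fin n))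

@[fun_prop]
theorem measurable_pd1 : Measurable (pd1 f) := measurable_fderiv_apply_const ℝ f (1, 0)

@[fun_prop]
theorem measurable_pd2 : Measurable (pd2 f) := measurable_fderiv_apply_const ℝ f (0, 1)

@[fun_prop]
theorem measurable_gradSq : Measurable (gradSq f) := by unfold gradSq; fun_prop

@[fun_prop]
theorem measurable_lap : Measurable (lap f) := by unfold lap; fun_prop

theorem measurable_curvatureRatio (r : ℝ) : Measurable (curvatureRatio f r) := by
  refine Measurable.indicator (by fun_prop) (((isOpen_disk r).measurableSet.diff
    (measurableSet_singleton 0)).inter ?_)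
  exact (measurable_gradSq f (measurableSet_singleton 0)).compl

theorem measurable_weight (δ : ℝ) : Measurable (weight δ) := by
  unfold weight; fun_prop

theorem lintegral_curvatureRatio_sq (r : ℝ) :
    ∫⁻ w, curvatureRatio f r w ^ 2 = willmore f (disk r \ {0}) := by
  have hm : MeasurableSet ((disk r \ {0}) ∩ {w | gradSq f w ≠ 0}) :=
    ((isOpen_disk r).measurableSet.diff (measurableSet_singleton 0)).inter
      (measurable_gradSq f (measurableSet_singleton 0)).compl
  rw [willmore, ← lintegral_indicator hm]
  refine lintegral_congr fun w => ?_
  by_cases hw : w ∈ (disk r \ {0}) ∩ {w | gradSq f w ≠ 0}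
  · have hpos : 0 < √(gradSq f w) := Real.sqrt_pos.2 ((gradSq_nonneg f w).lt_of_ne' hw.2)
    rw [curvatureRatio, indicator_of_mem hw, indicator_of_mem hw, ← ofReal_norm,
      ← ENNReal.ofReal_div_of_pos hpos, ← ENNReal.ofReal_pow (by positivity), div_pow,
      Real.sq_sqrt (gradSq_nonneg f w)]
  · rw [curvatureRatio, indicator_of_notMem hw, indicator_of_notMem hw]
    simp

theorem disk_subset_ball {r : ℝ} (hr : 0 ≤ r) : disk r ⊆ Metric.ball 0 r := by
  intro w hw
  have h : w.1 ^ 2 + w.2 ^ 2 < r ^ 2 := hw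
  rw [← norm_toC_sq] at h
  rw [mem_ball_zero_iff]
  exact (norm_le_norm_toC w).trans_lt (lt_of_pow_lt_pow_left₀ 2 hr h)

theorem disk_subset_disk {r s : ℝ} (hr : 0 ≤ r) (hrs : r ≤ s) : disk r ⊆ disk s := by
  intro w hw
  have h : w.1 ^ 2 + w.2 ^ 2 < r ^ 2 := hw
  show w.1 ^ 2 + w.2 ^ 2 < s ^ 2
  nlinarith

theorem exists_willmore_le (hW : willmore f (disk 1 \ {0}) < ⊤) {ε : ℝ≥0∞} (hε : ε ≠ 0) :
    ∃ r : ℝ, 0 < r ∧ 2 * r ≤ 1 ∧ willmore f (disk (2 * r) \ {0}) ≤ ε := by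
  obtain ⟨δ, hδ, h⟩ := exists_pos_setLIntegral_lt_of_measure_lt hW.ne hε
  have hlim : Tendsto (fun r : ℝ => ENNReal.ofReal ((2 * r) ^ 2) * volume (Metric.ball (0 : ℝ × ℝ) 1))
      (nhdsWithin 0 (Ioi 0)) (nhds 0) := by
    have h1 : Tendsto (fun r : ℝ => ENNReal.ofReal ((2 * r) ^ 2) *
        volume (Metric.ball (0 : ℝ × ℝ) 1)) (nhds 0)
        (nhds (ENNReal.ofReal ((2 * 0) ^ 2) * volume (Metric.ball (0 : ℝ × ℝ) 1))) :=
      ENNReal.Tendsto.mul_const (ENNReal.tendsto_ofReal (Continuous.tendsto (by fun_prop) 0))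
        (Or.inr measure_ball_lt_top.ne)
    simpa using h1.mono_left nhdsWithin_le_nhds
  have hev : ∀ᶠ r : ℝ in nhdsWithin 0 (Ioi 0), r < 1 / 2 :=
    nhdsWithin_le_nhds (gt_mem_nhds (by norm_num))
  obtain ⟨r, ⟨hr1, hr2⟩, hr0⟩ := ((hlim.eventually_lt_const hδ).and hev |>.and
    self_mem_nhdsWithin).exists
  have hr0' : 0 < r := hr0
  refine ⟨r, hr0', by linarith, ?_⟩
  have hm : MeasurableSet (disk (2 * r) \ {0}) :=
    (isOpen_disk _).measurableSet.diff (measurableSet_singleton 0)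
  have hμ : (volume.restrict ((disk 1 \ {0}) ∩ {w | gradSq f w ≠ 0})) (disk (2 * r) \ {0}) < δ := by
    refine (Measure.restrict_apply_le _ _).trans_lt (lt_of_le_of_lt ?_ hr1)
    refine (measure_mono (sdiff_subset.trans (disk_subset_ball (by positivity)))).trans ?_
    rw [Measure.addHaar_ball _ _ (by positivity)]
    simp
  have h2 := h _ hμ
  rw [Measure.restrict_restrict hm, ← inter_assoc, inter_eq_left.2
    (sdiff_subset_sdiff_left (disk_subset_disk (by positivity) (by linarith)))] at h2
  exact h2.le

theorem exists_lintegral_cut_sq_le : ∃ C : ℝ≥0∞, C ≠ ⊤ ∧ ∀ (s A : ℝ) (x : ℝ × ℝ), 0 < s →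
    2 * s ^ 2 < 1 → 0 ≤ A →
    (∫⁻ w, {w : ℝ × ℝ | w ≠ 0 ∧ w.1 ^ 2 + w.2 ^ 2 ≤ 2 * s ^ 2}.indicator
        (fun w => ENNReal.ofReal (A * √(gradSq f w))) w * ‖x - w‖ₑ ^ (-(3 / 4) : ℝ)) ^ 2 ≤
      C * ENNReal.ofReal (A ^ 2 * √(2 * s)) * ∫⁻ z in disk 1 \ {0}, ENNReal.ofReal (gradSq f z) := by
  obtain ⟨C, hC, hCb⟩ := lintegral_riesz_ball_zero (3 / 2) (by norm_num) (by norm_num)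
  refine ⟨C, hC, fun s A x hs hs1 hA => ?_⟩
  have hm1 : MeasurableSet (disk 1 \ {0}) :=
    (isOpen_disk _).measurableSet.diff (measurableSet_singleton 0)
  have h := sq_lintegral_le_mul (μ := volume)
    (c := fun w => {w : ℝ × ℝ | w ≠ 0 ∧ w.1 ^ 2 + w.2 ^ 2 ≤ 2 * s ^ 2}.indicator
        (fun w => ENNReal.ofReal (A * √(gradSq f w))) w * ‖x - w‖ₑ ^ (-(3 / 4) : ℝ))
    (f := (disk 1 \ {0}).indicator fun w => ENNReal.ofReal (A ^ 2) * ENNReal.ofReal (gradSq f w))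
    (g := (Metric.ball 0 (2 * s)).indicator fun w => ‖x - w‖ₑ ^ (-(3 / 2) : ℝ))
    (Measurable.indicator (by fun_prop) hm1).aemeasurable
    (Measurable.indicator (by fun_prop) Metric.isOpen_ball.measurableSet).aemeasurable (by
      intro w
      by_cases hw : w ∈ {w : ℝ × ℝ | w ≠ 0 ∧ w.1 ^ 2 + w.2 ^ 2 ≤ 2 * s ^ 2}
      · have hw2 : w.1 ^ 2 + w.2 ^ 2 ≤ 2 * s ^ 2 := hw.2
        have h1 : w ∈ disk 1 \ {0} := ⟨show w.1 ^ 2 + w.2 ^ 2 < 1 ^ 2 by linarith, hw.1⟩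
        have h2 : w ∈ Metric.ball (0 : ℝ × ℝ) (2 * s) :=
          disk_subset_ball (by positivity) (show w.1 ^ 2 + w.2 ^ 2 < (2 * s) ^ 2 by nlinarith)
        rw [indicator_of_mem hw, indicator_of_mem h1, indicator_of_mem h2, mul_pow,
          enorm_rpow_sq (x - w) (t := 3 / 2) (by norm_num), ← ENNReal.ofReal_pow (by positivity),
          ← ENNReal.ofReal_mul (by positivity), mul_pow, Real.sq_sqrt (gradSq_nonneg f w)]
      · rw [indicator_of_notMem hw]
        simp)
  refine h.trans ?_
  rw [lintegral_indicator hm1, lintegral_indicator Metric.isOpen_ball.measurableSet,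
    lintegral_const_mul' _ _ ENNReal.ofReal_ne_top]
  refine (mul_le_mul_right (hCb x (2 * s) (by positivity)) _).trans (le_of_eq ?_)
  rw [ENNReal.ofReal_mul (by positivity), Real.sqrt_eq_rpow, show (2 : ℝ) - 3 / 2 = 1 / 2 by norm_num]
  ring

theorem ennreal_le_one_add_of_sq_le {x A : ℝ≥0∞} (h : x ^ 2 ≤ A) : x ≤ 1 + A := by
  rcases le_total x 1 with h1 | h1
  · exact h1.trans le_self_add
  · refine (le_trans ?_ h).trans le_add_self
    rw [sq]
    exact le_mul_of_one_le_left' h1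

end Estimates

section Removability

variable {n : ℕ} {f : ℝ × ℝ → EuclideanSpace ℝ (Fin n)}

theorem exists_weight_mul_deriv_cutoff_le : ∃ L : ℝ, 0 ≤ L ∧
    ∀ (f : ℝ × ℝ → EuclideanSpace ℝ (Fin n)) (δ s r : ℝ) (w : ℝ × ℝ), 0 < δ → 0 < s → 0 < r →
    weight δ w * ENNReal.ofReal
        (2 * |deriv (cutoff (s ^ 2) (r ^ 2)) (w.1 ^ 2 + w.2 ^ 2)| * ‖toC w‖ * √(gradSq f w)) ≤
      {w : ℝ × ℝ | w ≠ 0 ∧ w.1 ^ 2 + w.2 ^ 2 ≤ 2 * s ^ 2}.indicator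
        (fun w => ENNReal.ofReal (L / δ * √(gradSq f w))) w +
      {w : ℝ × ℝ | w ≠ 0 ∧ w.1 ^ 2 + w.2 ^ 2 ≤ 2 * r ^ 2}.indicator
        (fun w => ENNReal.ofReal (L / r * √(gradSq f w))) w := by
  obtain ⟨L, hL0, hL⟩ := exists_bound_deriv_cutoff
  refine ⟨4 * L, by positivity, fun f δ s r w hδ hs hr => ?_⟩
  by_cases hw0 : w = 0
  · simp [hw0]
  have hN := norm_toC_sq w
  have hd := hL (s ^ 2) (r ^ 2) (w.1 ^ 2 + w.2 ^ 2) (by positivity) (by positivity)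
  rw [← hN] at hd ⊢
  set P := √(gradSq f w)
  set N := ‖toC w‖ with hNdef
  have hN0 : 0 ≤ N := norm_nonneg _
  have hP0 : 0 ≤ P := Real.sqrt_nonneg _
  set i₁ := (Iic (2 * s ^ 2)).indicator (fun _ => L / s ^ 2) (N ^ 2) with hi₁
  set i₂ := (Iic (2 * r ^ 2)).indicator (fun _ => L / r ^ 2) (N ^ 2) with hi₂
  have hi₁0 : 0 ≤ i₁ := indicator_nonneg (fun _ _ => by positivity) _
  have hi₂0 : 0 ≤ i₂ := indicator_nonneg (fun _ _ => by positivity) _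
  have hle : 2 * |deriv (cutoff (s ^ 2) (r ^ 2)) (N ^ 2)| * N * P ≤
      i₁ * (2 * N * P) + i₂ * (2 * N * P) := by
    rw [← add_mul, show ∀ x : ℝ, 2 * x * N * P = x * (2 * N * P) by intro x; ring]
    exact mul_le_mul_of_nonneg_right hd (by positivity)
  refine (mul_le_mul_right (ENNReal.ofReal_le_ofReal hle) _).trans ?_
  rw [ENNReal.ofReal_add (by positivity) (by positivity), mul_add]
  refine add_le_add ?_ ?_
  · by_cases h : N ^ 2 ≤ 2 * s ^ 2
    · rw [hi₁, indicator_of_mem (by exact h), indicator_of_mem (by exact ⟨hw0, hN ▸ h⟩)]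
      refine (mul_le_mul_left (min_le_right _ _) _).trans ?_
      rw [← ofReal_norm, ← ENNReal.ofReal_div_of_pos hδ, ← ENNReal.ofReal_mul (by positivity)]
      refine ENNReal.ofReal_le_ofReal ?_
      calc ‖toC w‖ / δ * (L / s ^ 2 * (2 * N * P)) = (2 * L / (δ * s ^ 2) * P) * N ^ 2 := by
            rw [← hNdef]; field_simp
        _ ≤ (2 * L / (δ * s ^ 2) * P) * (2 * s ^ 2) := mul_le_mul_of_nonneg_left h (by positivity)
        _ = 4 * L / δ * P := by field_simp; ring
    · rw [hi₁, indicator_of_notMem (by exact h)]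
      simp
  · by_cases h : N ^ 2 ≤ 2 * r ^ 2
    · rw [hi₂, indicator_of_mem (by exact h), indicator_of_mem (by exact ⟨hw0, hN ▸ h⟩)]
      refine (mul_le_mul_left (min_le_left _ _) _).trans ?_
      rw [one_mul]
      refine ENNReal.ofReal_le_ofReal ?_
      have hNr : N ≤ 2 * r := by nlinarith
      calc L / r ^ 2 * (2 * N * P) = (2 * L / r ^ 2 * P) * N := by ring
        _ ≤ (2 * L / r ^ 2 * P) * (2 * r) := mul_le_mul_of_nonneg_left hNr (by positivity)
        _ = 4 * L / r * P := by field_simp; ring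
    · rw [hi₂, indicator_of_notMem (by exact h)]
      simp

theorem continuousOn_gradSq (hsm : ContDiffOn ℝ (⊤ : ℕ∞) f (disk 1 \ {0})) :
    ContinuousOn (gradSq f) (disk 1 \ {0}) := by
  intro w hw
  have h : ContinuousAt (fderiv ℝ f) w :=
    ((hsm.contDiffAt_punctured hw).fderiv_right (m := 0) (by simp)).continuousAt
  unfold gradSq pd1 pd2
  exact ContinuousAt.continuousWithinAt (by fun_prop)

theorem exists_gradSq_bound (hsm : ContDiffOn ℝ (⊤ : ℕ∞) f (disk 1 \ {0})) {a b : ℝ} (ha : 0 < a)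
    (hb : b < 1) : ∃ M : ℝ, ∀ w : ℝ × ℝ, a ≤ w.1 ^ 2 + w.2 ^ 2 → w.1 ^ 2 + w.2 ^ 2 ≤ b →
      √(gradSq f w) ≤ M := by
  have hc : Continuous fun w : ℝ × ℝ => w.1 ^ 2 + w.2 ^ 2 := by fun_prop
  have hcl : IsClosed {w : ℝ × ℝ | a ≤ w.1 ^ 2 + w.2 ^ 2 ∧ w.1 ^ 2 + w.2 ^ 2 ≤ b} :=
    (isClosed_le continuous_const hc).inter (isClosed_le hc continuous_const)
  have hsub : {w : ℝ × ℝ | a ≤ w.1 ^ 2 + w.2 ^ 2 ∧ w.1 ^ 2 + w.2 ^ 2 ≤ b} ⊆ disk 1 \ {0} := by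
    rintro w ⟨h1, h2⟩
    refine ⟨show w.1 ^ 2 + w.2 ^ 2 < 1 ^ 2 by linarith, ?_⟩
    rintro rfl
    simp at h1
    linarith
  have hK := (isCompact_closedBall (0 : ℝ × ℝ) 1).of_isClosed_subset hcl ((hsub.trans
    sdiff_subset).trans ((disk_subset_ball zero_le_one).trans Metric.ball_subset_closedBall))
  obtain ⟨M, hM⟩ := hK.exists_bound_of_continuousOn
    ((Real.continuous_sqrt.comp_continuousOn (continuousOn_gradSq hsm)).mono hsub)
  exact ⟨M, fun w h1 h2 => (le_abs_self _).trans (hM w ⟨h1, h2⟩)⟩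

theorem exists_lintegral_weight_pow_four_le (hsm : ContDiffOn ℝ (⊤ : ℕ∞) f (disk 1 \ {0}))
    (hconf : ∀ z ∈ disk 1 \ {0}, ‖pd1 f z‖ ^ 2 = ‖pd2 f z‖ ^ 2 ∧ ⟪pd1 f z, pd2 f z⟫ = 0)
    (hH : ∀ z ∈ disk 1 \ {0}, fderiv ℝ f z = 0 → lap f z = 0)
    (hE : ∫⁻ z in disk 1 \ {0}, ENNReal.ofReal (gradSq f z) < ⊤)
    (hW : willmore f (disk 1 \ {0}) < ⊤) :
    ∃ (r : ℝ) (B : ℝ≥0∞), 0 < r ∧ B ≠ ⊤ ∧ ∀ δ : ℝ, 0 < δ → δ ≤ 1 / 2 →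
      ∫⁻ z, (weight δ z * ENNReal.ofReal
        (cutoff ((δ ^ 4) ^ 2) (r ^ 2) (z.1 ^ 2 + z.2 ^ 2) * √(gradSq f z))) ^ 4 ≤ B := by
  obtain ⟨ε, C, hε, hC, hmain⟩ := lintegral_pow_four_le_of_le_potential
  obtain ⟨r, hr0, hr1, hWr⟩ := exists_willmore_le f hW hε
  obtain ⟨L, hL0, hL⟩ := exists_weight_mul_deriv_cutoff_le (n := n)
  obtain ⟨C', hC', hcut⟩ := exists_lintegral_cut_sq_le f
  set E := ∫⁻ z in disk 1 \ {0}, ENNReal.ofReal (gradSq f z)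
  set T : ℝ≥0∞ := (1 + C' * ENNReal.ofReal (2 * L ^ 2) * E) +
    (1 + C' * ENNReal.ofReal ((L / r) ^ 2 * √(2 * r)) * E) with hT
  have hTtop : T ≠ ⊤ := by
    simp only [hT, ne_eq, ENNReal.add_eq_top, not_or]
    refine ⟨⟨by simp, ?_⟩, by simp, ?_⟩ <;>
    exact ENNReal.mul_ne_top (ENNReal.mul_ne_top hC' ENNReal.ofReal_ne_top) hE.ne
  refine ⟨r, C * T ^ 4, hr0, ENNReal.mul_ne_top hC (ENNReal.pow_ne_top hTtop), fun δ hδ hδ1 => ?_⟩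
  set s := δ ^ 4 with hs
  have hs0 : 0 < s := by positivity
  have hs1 : s ≤ 1 / 2 := (pow_le_of_le_one hδ.le (by linarith) (by norm_num)).trans hδ1
  set χ := cutoff (s ^ 2) (r ^ 2) with hχ
  have hca : ∀ t ≤ s ^ 2, χ t = 0 := fun t => cutoff_eq_zero_of_le (by positivity)
  have hcb : ∀ t, 2 * r ^ 2 ≤ t → χ t = 0 := fun t => cutoff_eq_zero_of_ge (by positivity)
  have hχ0 : ∀ t, 0 ≤ χ t := cutoff_nonneg _ _
  have hb1 : 2 * r ^ 2 < 1 := by nlinarith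
  obtain ⟨M, hM⟩ := exists_gradSq_bound hsm (a := s ^ 2) (by positivity) hb1
  have hχc : ContDiff ℝ (⊤ : ℕ∞) χ := contDiff_cutoff _ _
  have hχm : Continuous χ := hχc.continuous
  have hχm' : Continuous (deriv χ) := hχc.continuous_deriv (by simp)
  have hball : ∀ z ∉ Metric.ball (0 : ℝ × ℝ) 1, 1 ≤ z.1 ^ 2 + z.2 ^ 2 := by
    intro z hz
    rw [mem_ball_zero_iff, not_lt] at hz
    have := norm_le_norm_toC z
    rw [← norm_toC_sq]
    nlinarith
  refine hmain _ (curvatureRatio f (2 * r)) (fun w => weight δ w *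
      ENNReal.ofReal (2 * |deriv χ (w.1 ^ 2 + w.2 ^ 2)| * ‖toC w‖ * √(gradSq f w)))
    (ENNReal.ofReal M) T ((measurable_weight δ).mul (by fun_prop))
    (measurable_curvatureRatio f _) ((measurable_weight δ).mul (by fun_prop))
    ENNReal.ofReal_ne_top hTtop ?_ ?_ ?_ ?_ ?_ ?_
  · exact weight_mul_cutoff_le_potential hχc hχ0 hca (by positivity) (by positivity) hr1 hcb
      (by nlinarith) hb1 hsm hconf hH δ
  · intro z hz
    simp [hcb _ (hb1.le.trans (hball z hz))]
  · intro z hz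
    have h : χ =ᶠ[nhds (z.1 ^ 2 + z.2 ^ 2)] fun _ => 0 := by
      filter_upwards [lt_mem_nhds (hb1.trans_le (hball z hz))] with t ht
      exact hcb t ht.le
    simp [h.deriv_eq]
  · intro z
    by_cases h1 : s ^ 2 ≤ z.1 ^ 2 + z.2 ^ 2
    · by_cases h2 : z.1 ^ 2 + z.2 ^ 2 ≤ 2 * r ^ 2
      · refine (mul_le_of_le_one_left' (min_le_left _ _)).trans (ENNReal.ofReal_le_ofReal ?_)
        exact (mul_le_of_le_one_left (Real.sqrt_nonneg _) (cutoff_le_one _ _ _)).trans (hM z h1 h2)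
      · simp [hcb _ (not_le.1 h2).le]
    · simp [hca _ (not_le.1 h1).le]
  · rw [lintegral_curvatureRatio_sq]
    exact hWr
  · intro x
    refine (lintegral_mono fun w => mul_le_mul_left (hL f δ s r w hδ hs0 hr0) _).trans ?_
    simp only [add_mul]
    have hmeas : Measurable fun w => {w : ℝ × ℝ | w ≠ 0 ∧ w.1 ^ 2 + w.2 ^ 2 ≤ 2 * s ^ 2}.indicator
        (fun w => ENNReal.ofReal (L / δ * √(gradSq f w))) w * ‖x - w‖ₑ ^ (-(3 / 4) : ℝ) := by
      refine Measurable.mul (Measurable.indicator (by fun_prop) ?_) (by fun_prop)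
      have hN : Measurable fun w : ℝ × ℝ => w.1 ^ 2 + w.2 ^ 2 := by fun_prop
      exact (measurableSet_singleton 0).compl.inter (measurableSet_le hN measurable_const)
    rw [lintegral_add_left hmeas]
    refine add_le_add (ennreal_le_one_add_of_sq_le ?_) (ennreal_le_one_add_of_sq_le ?_)
    · refine (hcut s (L / δ) x hs0 (by nlinarith) (by positivity)).trans ?_
      gcongr C' * ENNReal.ofReal ?_ * _
      have h1 : √(2 * s) ≤ 2 * δ ^ 2 := by
        rw [Real.sqrt_le_left (by positivity), hs]
        nlinarith [pow_pos hδ 4]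
      calc (L / δ) ^ 2 * √(2 * s) ≤ (L / δ) ^ 2 * (2 * δ ^ 2) := by gcongr
        _ = 2 * L ^ 2 := by field_simp
    · exact hcut r (L / r) x hr0 hb1 (by positivity)

theorem exists_lintegral_gradSq_pow_four_lt_top
    (hsm : ContDiffOn ℝ (⊤ : ℕ∞) f (disk 1 \ {0}))
    (hconf : ∀ z ∈ disk 1 \ {0}, ‖pd1 f z‖ ^ 2 = ‖pd2 f z‖ ^ 2 ∧ ⟪pd1 f z, pd2 f z⟫ = 0)
    (hH : ∀ z ∈ disk 1 \ {0}, fderiv ℝ f z = 0 → lap f z = 0)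
    (hE : ∫⁻ z in disk 1 \ {0}, ENNReal.ofReal (gradSq f z) < ⊤)
    (hW : willmore f (disk 1 \ {0}) < ⊤) :
    ∃ r : ℝ, 0 < r ∧ ∫⁻ z in disk r \ {0}, ENNReal.ofReal √(gradSq f z) ^ 4 < ⊤ := by
  obtain ⟨r, B, hr, hB, h⟩ := exists_lintegral_weight_pow_four_le hsm hconf hH hE hW
  refine ⟨r, hr, lt_of_le_of_lt ?_ hB.lt_top⟩
  set δ : ℕ → ℝ := fun k => 1 / ((k : ℝ) + 2) with hδ
  have hδ0 : ∀ k, 0 < δ k := fun k => by positivity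
  have hδ2 : ∀ k, δ k ≤ 1 / 2 := fun k => by
    simp only [hδ]
    gcongr
    linarith [(Nat.cast_nonneg k : (0 : ℝ) ≤ k)]
  have hlim : Tendsto δ atTop (nhds 0) := by
    have := (tendsto_one_div_add_atTop_nhds_zero_nat (𝕜 := ℝ)).comp (tendsto_add_atTop_nat 1)
    refine this.congr fun k => ?_
    simp only [hδ, Function.comp]
    push_cast
    ring
  set u : ℕ → ℝ × ℝ → ℝ≥0∞ := fun k z => (weight (δ k) z * ENNReal.ofReal
    (cutoff ((δ k ^ 4) ^ 2) (r ^ 2) (z.1 ^ 2 + z.2 ^ 2) * √(gradSq f z))) ^ 4 with hu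
  have hum : ∀ k, Measurable (u k) := by
    intro k
    have hc := (contDiff_cutoff ((δ k ^ 4) ^ 2) (r ^ 2)).continuous
    exact ((measurable_weight _).mul (by fun_prop)).pow_const 4
  have hm : MeasurableSet (disk r \ {0}) :=
    (isOpen_disk _).measurableSet.diff (measurableSet_singleton 0)
  have heq : ∀ z ∈ disk r \ {0}, ENNReal.ofReal √(gradSq f z) ^ 4 = liminf (fun k => u k z) atTop := by
    rintro z ⟨hz, hz0⟩
    have hz1 : z.1 ^ 2 + z.2 ^ 2 < r ^ 2 := hz
    have hpos : 0 < ‖toC z‖ := norm_pos_iff.2 (toC_ne_zero hz0)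
    have hev1 : ∀ᶠ k in atTop, δ k ≤ ‖toC z‖ := hlim.eventually_le_const hpos
    have hev2 : ∀ᶠ k in atTop, 2 * (δ k ^ 4) ^ 2 ≤ ‖toC z‖ ^ 2 := by
      have h1 : Tendsto (fun k => 2 * (δ k ^ 4) ^ 2) atTop (nhds 0) := by
        have := ((hlim.pow 4).pow 2).const_mul 2
        simpa using this
      exact h1.eventually_le_const (by positivity)
    refine (Tendsto.liminf_eq (tendsto_const_nhds.congr' ?_)).symm
    filter_upwards [hev1, hev2] with k h1 h2
    have hw : weight (δ k) z = 1 := by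
      rw [weight, min_eq_left]
      rw [ENNReal.le_div_iff_mul_le (Or.inl (by simpa using hδ0 k)) (Or.inl (by simp)), one_mul,
        ← ofReal_norm]
      exact ENNReal.ofReal_le_ofReal h1
    simp only [hu]
    rw [hw, cutoff_eq_one (by have := hδ0 k; positivity) (by positivity) (by rwa [← norm_toC_sq]) hz1.le,
      one_mul, one_mul]
  rw [setLIntegral_congr_fun hm heq]
  refine (setLIntegral_le_lintegral _ _).trans ((lintegral_liminf_le hum).trans ?_)
  exact liminf_le_of_le (by isBoundedDefault) fun b hb => by
    obtain ⟨k, hk⟩ := hb.exists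
    exact hk.trans (h (δ k) (hδ0 k) (hδ2 k))

end Removability

/-- Removability of a point singularity (Proposition 2.4), gradient integrability. -/
theorem removable_singularity_gradient (n : ℕ) (f : ℝ × ℝ → EuclideanSpace ℝ (Fin n))
    (hsm : ContDiffOn ℝ (⊤ : ℕ∞) f (disk 1 \ {0}))
    (hbd : ∃ R : ℝ, ∀ z ∈ disk 1 \ {0}, ‖f z‖ ≤ R)
    (hconf : ∀ z ∈ disk 1 \ {0},
        ‖pd1 f z‖ ^ 2 = ‖pd2 f z‖ ^ 2 ∧ ⟪pd1 f z, pd2 f z⟫ = 0)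
    (hH : ∀ z ∈ disk 1 \ {0}, fderiv ℝ f z = 0 → lap f z = 0)
    (hE : ∫⁻ z in disk 1 \ {0}, ENNReal.ofReal (gradSq f z) < ⊤)
    (hW : willmore f (disk 1 \ {0}) < ⊤) :
    ∀ q : ℝ, 2 < q → q < 4 →
      ∫⁻ z in disk (1/2) \ {0}, ENNReal.ofReal (Real.sqrt (gradSq f z) ^ q) < ⊤ := by
  intro q hq2 hq4
  obtain ⟨r, hr, hP⟩ := exists_lintegral_gradSq_pow_four_lt_top hsm hconf hH hE hW
  obtain ⟨M, hM⟩ := exists_gradSq_bound hsm (a := r ^ 2) (b := 1 / 4) (by positivity) (by norm_num)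
  have hmr : MeasurableSet (disk r \ {0}) :=
    (isOpen_disk _).measurableSet.diff (measurableSet_singleton 0)
  have hm : MeasurableSet (disk (1 / 2) \ {0}) :=
    (isOpen_disk _).measurableSet.diff (measurableSet_singleton 0)
  have hle : ∀ z ∈ disk (1 / 2) \ {0}, ENNReal.ofReal (√(gradSq f z) ^ q) ≤
      (1 + ENNReal.ofReal M ^ 4) +
        (disk r \ {0}).indicator (fun z => ENNReal.ofReal √(gradSq f z) ^ 4) z := by
    intro z hz
    have hz1 : z.1 ^ 2 + z.2 ^ 2 < (1 / 2) ^ 2 := hz.1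
    have h1 : ENNReal.ofReal (√(gradSq f z) ^ q) ≤ 1 + ENNReal.ofReal √(gradSq f z) ^ 4 := by
      rcases le_total √(gradSq f z) 1 with h | h
      · refine le_trans ?_ le_self_add
        rw [ENNReal.ofReal_le_one]
        exact Real.rpow_le_one (Real.sqrt_nonneg _) h (by linarith)
      · refine le_trans ?_ le_add_self
        rw [← ENNReal.ofReal_pow (Real.sqrt_nonneg _)]
        refine ENNReal.ofReal_le_ofReal ?_
        rw [← Real.rpow_natCast]
        exact Real.rpow_le_rpow_of_exponent_le h (by push_cast; linarith)
    by_cases hzr : z.1 ^ 2 + z.2 ^ 2 < r ^ 2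
    · rw [indicator_of_mem (show z ∈ disk r \ {0} from ⟨hzr, hz.2⟩), add_right_comm]
      exact h1.trans le_self_add
    · rw [indicator_of_notMem (fun h : z ∈ disk r \ {0} => hzr h.1), add_zero]
      refine h1.trans ?_
      gcongr
      exact hM z (not_lt.1 hzr) (by linarith)
  refine (setLIntegral_mono' hm hle).trans_lt ?_
  rw [lintegral_add_left measurable_const, lintegral_const, Measure.restrict_apply_univ]
  refine ENNReal.add_lt_top.2 ⟨ENNReal.mul_lt_top (by simp) ?_, ?_⟩
  · exact (measure_mono (sdiff_subset.trans (disk_subset_ball (by norm_num)))).trans_lt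
      measure_ball_lt_top
  · refine (setLIntegral_le_lintegral _ _).trans_lt ?_
    rwa [lintegral_indicator hmr]
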